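/- arXiv:2505.08045 — 8 statements merged into one kernel-verified Lean document; each statement's English description precedes it below -/
import Mathlib

section
/- Let m, n ≥ 1 and let D be an m×n grid copula matrix, and let C_B^D be the associated Bernstein copula. Then ∫_{[0,1]²} ∂₁C_B^D(u,v) · ∂₂C_B^D(u,v) du dv = (1/4) tr(Θ^{(m)} D Θ^{(n)} Dᵀ), where Θ^{(m)} is the m×m matrix with Θ^{(m)}_{i,j} = (i−j)·C(m,i)·C(m,j) / ((2m−i−j)·C(2m−1, i+j−1)) for (i,j) ≠ (m,m) and Θ^{(m)}_{m,m} = 1, and Θ^{(n)} is defined analogously with m replaced by n. Consequently Kendall's tau τ(C_B^D) = 1 − 4∫_{[0,1]²} ∂₁C_B^D ∂₂C_B^D dλ² equals 1 − tr(Θ^{(m)} D Θ^{(n)} Dᵀ). -/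
open MeasureTheory

/-- The Bernstein basis polynomial `B_{i,m}(u) = C(m,i) u^i (1-u)^(m-i)`. -/
noncomputable def bern (m i : ℕ) (u : ℝ) : ℝ :=
  (m.choose i : ℝ) * u ^ i * (1 - u) ^ (m - i)

/-- A bivariate copula: grounded, uniform marginals and 2-increasing. -/
def IsCopula (C : ℝ → ℝ → ℝ) : Prop :=
  (∀ u ∈ Set.Icc (0:ℝ) 1, C u 0 = 0 ∧ C 0 u = 0 ∧ C u 1 = u ∧ C 1 u = u) ∧
  (∀ u₁ v₁ u₂ v₂ : ℝ, 0 ≤ u₁ → u₁ ≤ v₁ → v₁ ≤ 1 → 0 ≤ u₂ → u₂ ≤ v₂ → v₂ ≤ 1 →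
    0 ≤ C v₁ v₂ - C u₁ v₂ - C v₁ u₂ + C u₁ u₂)

/-- `D` is a grid copula matrix: `D_{i,j} = C(i/m, j/n)` for some bivariate copula `C`. -/
def IsGridCopulaMatrix (m n : ℕ) (D : Matrix (Fin m) (Fin n) ℝ) : Prop :=
  ∃ C : ℝ → ℝ → ℝ, IsCopula C ∧
    ∀ i j, D i j = C (((i.1 : ℝ) + 1) / m) (((j.1 : ℝ) + 1) / n)

/-- The Bernstein copula associated with the matrix `D`. -/
noncomputable def bernCop (m n : ℕ) (D : Matrix (Fin m) (Fin n) ℝ) (u v : ℝ) : ℝ :=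
  ∑ i : Fin m, ∑ j : Fin n, D i j * bern m (i.1 + 1) u * bern n (j.1 + 1) v

/-- The matrix `Θ^{(m)}` with `Θ_{i,j} = (i−j) C(m,i) C(m,j) / ((2m−i−j) C(2m−1, i+j−1))`
for `(i,j) ≠ (m,m)` and `Θ_{m,m} = 1` (indices 1-based). -/
noncomputable def thetaMat (m : ℕ) : Matrix (Fin m) (Fin m) ℝ := fun i j =>
  if i.1 + 1 = m ∧ j.1 + 1 = m then 1
  else (((i.1 : ℝ) + 1) - ((j.1 : ℝ) + 1)) * (m.choose (i.1 + 1)) * (m.choose (j.1 + 1)) /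
    (((2 * m : ℝ) - ((i.1 : ℝ) + 1) - ((j.1 : ℝ) + 1)) *
      ((2 * m - 1).choose (i.1 + j.1 + 1)))

theorem integral_pow_mul_one_sub_pow (a b : ℕ) :
    ∫ u in (0:ℝ)..1, u ^ a * (1 - u) ^ b =
      (a.factorial * b.factorial : ℝ) / (a + b + 1).factorial := by
  induction b generalizing a with
  | zero =>
    simp only [pow_zero, mul_one, integral_pow, Nat.factorial_zero, Nat.cast_one, add_zero,
      Nat.factorial_succ]
    have := Nat.cast_ne_zero (R := ℝ).2 a.factorial_ne_zero
    push_cast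
    field_simp
    simp
  | succ b ih =>
    have parts := intervalIntegral.integral_mul_deriv_eq_deriv_mul_of_hasDerivAt
      (a := (0:ℝ)) (b := 1) (u := fun u : ℝ => (1 - u) ^ (b + 1))
      (u' := fun u : ℝ => -((b + 1 : ℝ) * (1 - u) ^ b)) (v := fun u : ℝ => u ^ (a + 1))
      (v' := fun u : ℝ => (a + 1 : ℝ) * u ^ a)
      (by fun_prop) (by fun_prop)
      (fun x _ => by
        refine (((hasDerivAt_id x).const_sub 1).fun_pow (b + 1)).congr_deriv ?_
        simp)
      (fun x _ => by
        refine (hasDerivAt_pow (a + 1) x).congr_deriv ?_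
        simp)
      (Continuous.intervalIntegrable (by fun_prop) _ _)
      (Continuous.intervalIntegrable (by fun_prop) _ _)
    have left : (∫ x in (0:ℝ)..1, (1 - x) ^ (b + 1) * ((a + 1 : ℝ) * x ^ a))
        = (a + 1 : ℝ) * ∫ x in (0:ℝ)..1, x ^ a * (1 - x) ^ (b + 1) := by
      rw [← intervalIntegral.integral_const_mul]
      congr 1; ext x; ring
    have right : (∫ x in (0:ℝ)..1, -((b + 1 : ℝ) * (1 - x) ^ b) * x ^ (a + 1))
        = -(b + 1 : ℝ) * ∫ x in (0:ℝ)..1, x ^ (a + 1) * (1 - x) ^ b := by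
      rw [← intervalIntegral.integral_const_mul]
      congr 1; ext x; ring
    rw [left, right, ih] at parts
    have ha : (a + 1 : ℝ) ≠ 0 := by positivity
    apply mul_left_cancel₀ ha
    rw [parts, show a + 1 + b + 1 = a + (b + 1) + 1 by ring, Nat.factorial_succ a,
      Nat.factorial_succ b]
    push_cast
    simp
    ring

theorem hasDerivAt_bern (m i : ℕ) (u : ℝ) :
    HasDerivAt (bern m i) ((m.choose i : ℝ) *
      (i * u ^ (i - 1) * (1 - u) ^ (m - i) - u ^ i * ((m - i : ℕ) * (1 - u) ^ (m - i - 1)))) u := by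
  have h := ((hasDerivAt_pow i u).const_mul (m.choose i : ℝ)).mul
    (((hasDerivAt_id u).const_sub 1).pow (m - i))
  refine h.congr_deriv ?_
  simp
  ring

theorem continuous_bern (m i : ℕ) : Continuous (bern m i) := by
  unfold bern; fun_prop

theorem continuous_deriv_bern (m i : ℕ) : Continuous (deriv (bern m i)) := by
  rw [funext fun u => (hasDerivAt_bern m i u).deriv]; fun_prop

theorem integral_deriv_bern_mul_bern (m : ℕ) (k l : Fin m) :
    ∫ u in (0:ℝ)..1, deriv (bern m (k.1 + 1)) u * bern m (l.1 + 1) u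
      = thetaMat m k l / 2 := by
  obtain ⟨a, ha⟩ := k
  obtain ⟨c, hc⟩ := l
  obtain ⟨p, hp⟩ := Nat.exists_eq_add_of_lt ha
  obtain ⟨q, hq⟩ := Nat.exists_eq_add_of_lt hc
  have hmp : m - (a + 1) = p := by omega
  have hmq : m - (c + 1) = q := by omega
  have integrand : ∀ u : ℝ, deriv (bern m (a + 1)) u * bern m (c + 1) u =
      (m.choose (a + 1) * m.choose (c + 1) : ℝ) *
        ((a + 1 : ℝ) * (u ^ (a + c + 1) * (1 - u) ^ (p + q))
        - (p : ℝ) * (u ^ (a + c + 2) * (1 - u) ^ (p + q - 1))) := by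
    intro u
    rw [(hasDerivAt_bern m (a + 1) u).deriv, bern, hmp, hmq]
    cases p with
    | zero => simp; ring
    | succ p =>
      rw [show p + 1 + q - 1 = p + q by omega]
      simp
      ring
  simp only [integrand]
  rw [intervalIntegral.integral_const_mul, intervalIntegral.integral_sub
      (Continuous.intervalIntegrable (by fun_prop) _ _)
      (Continuous.intervalIntegrable (by fun_prop) _ _),
    intervalIntegral.integral_const_mul, intervalIntegral.integral_const_mul,
    integral_pow_mul_one_sub_pow, integral_pow_mul_one_sub_pow]
  have fact_ne := fun n : ℕ => Nat.cast_ne_zero (R := ℝ).2 n.factorial_ne_zero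
  rcases Nat.eq_zero_or_pos (p + q) with h0 | hpos
  · obtain ⟨rfl, rfl⟩ : p = 0 ∧ q = 0 := by omega
    obtain rfl : c = a := by omega
    obtain rfl : m = c + 1 := by omega
    simp only [thetaMat, and_self, if_true, add_zero, 
      Nat.choose_self, Nat.factorial_succ (c + c + 1)]
    have := fact_ne (c + c + 1)
    push_cast
    field_simp
    simp
    ring
  · obtain ⟨t, ht⟩ : ∃ t, p + q = t + 1 := ⟨p + q - 1, by omega⟩
    have hne : ¬ (a + 1 = m ∧ c + 1 = m) := by omega
    have hchoose : ((2 * m - 1).choose (a + c + 1) : ℝ)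
        = (a + c + 1 + (t + 1)).factorial / ((a + c + 1).factorial * (t + 1).factorial) := by
      rw [show 2 * m - 1 = a + c + 1 + (t + 1) by omega, Nat.cast_add_choose]
    have hden : (2 * m : ℝ) - (a + 1) - (c + 1) = t + 1 := by
      have : 2 * m = (a + 1) + (c + 1) + (t + 1) := by omega
      have : (2 * m : ℝ) = (a + 1) + (c + 1) + (t + 1) := by exact_mod_cast this
      linarith
    have hpR : (p : ℝ) = c + q - a := by
      have : a + p = c + q := by omega
      have : (a + p : ℝ) = c + q := by exact_mod_cast this
      linarith
    have htR : (p + q : ℝ) = t + 1 := by exact_mod_cast ht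
    simp only [thetaMat, hne, if_false, hchoose, hden, ht, Nat.add_sub_cancel]
    rw [show a + c + 2 + t + 1 = a + c + 1 + (t + 1) + 1 by ring,
      show a + c + 2 = a + c + 1 + 1 by ring, Nat.factorial_succ (a + c + 1 + (t + 1)),
      Nat.factorial_succ (a + c + 1), Nat.factorial_succ t]
    have h1 := fact_ne (a + c + 1 + (t + 1))
    have h2 := fact_ne (a + c + 1)
    have h3 := fact_ne t
    have h4 : (a + c + 1 + (t + 1) + 1 : ℝ) ≠ 0 := by positivity
    have h5 : (t + 1 : ℝ) ≠ 0 := by positivity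
    push_cast
    field_simp
    have hq : (q : ℝ) = (t + 1 - c + a) / 2 := by linarith
    rw [hpR, hq]
    ring

theorem deriv_bernCop_left (m n : ℕ) (D : Matrix (Fin m) (Fin n) ℝ) (u v : ℝ) :
    deriv (fun x => bernCop m n D x v) u =
      ∑ p : Fin m × Fin n, D p.1 p.2 * deriv (bern m (p.1.1 + 1)) u * bern n (p.2.1 + 1) v := by
  rw [Fintype.sum_prod_type]
  refine HasDerivAt.deriv (HasDerivAt.fun_sum fun i _ => HasDerivAt.fun_sum fun j _ => ?_)
  exact ((hasDerivAt_bern m (i.1 + 1) u).differentiableAt.hasDerivAt.const_mul _).mul_const _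

theorem deriv_bernCop_right (m n : ℕ) (D : Matrix (Fin m) (Fin n) ℝ) (u v : ℝ) :
    deriv (fun y => bernCop m n D u y) v =
      ∑ p : Fin m × Fin n, D p.1 p.2 * bern m (p.1.1 + 1) u * deriv (bern n (p.2.1 + 1)) v := by
  rw [Fintype.sum_prod_type]
  refine HasDerivAt.deriv (HasDerivAt.fun_sum fun i _ => HasDerivAt.fun_sum fun j _ => ?_)
  exact (hasDerivAt_bern n (j.1 + 1) v).differentiableAt.hasDerivAt.const_mul _

theorem integral_deriv_bernCop_mul_deriv_bernCop (m n : ℕ) (D : Matrix (Fin m) (Fin n) ℝ) :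
    (∫ u in (0:ℝ)..1, ∫ v in (0:ℝ)..1,
        deriv (fun x => bernCop m n D x v) u * deriv (fun y => bernCop m n D u y) v)
      = (1 / 4) * Matrix.trace (thetaMat m * D * thetaMat n * D.transpose) := by
  have hb := continuous_bern
  have hb' := continuous_deriv_bern
  have integrand : ∀ u v : ℝ,
      deriv (fun x => bernCop m n D x v) u * deriv (fun y => bernCop m n D u y) v =
      ∑ p : Fin m × Fin n, ∑ q : Fin m × Fin n,
        (D p.1 p.2 * D q.1 q.2 * (deriv (bern m (p.1.1 + 1)) u * bern m (q.1.1 + 1) u)) *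
          (deriv (bern n (q.2.1 + 1)) v * bern n (p.2.1 + 1) v) := by
    intro u v
    rw [deriv_bernCop_left, deriv_bernCop_right, Finset.sum_mul_sum]
    refine Finset.sum_congr rfl fun p _ => Finset.sum_congr rfl fun q _ => ?_
    ring
  have inner : ∀ u : ℝ, (∫ v in (0:ℝ)..1,
      deriv (fun x => bernCop m n D x v) u * deriv (fun y => bernCop m n D u y) v) =
      ∑ p : Fin m × Fin n, ∑ q : Fin m × Fin n,
        (D p.1 p.2 * D q.1 q.2 * (thetaMat n q.2 p.2 / 2)) *
          (deriv (bern m (p.1.1 + 1)) u * bern m (q.1.1 + 1) u) := by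
    intro u
    simp only [integrand]
    rw [intervalIntegral.integral_finsetSum
      fun p _ => Continuous.intervalIntegrable (by fun_prop) _ _]
    refine Finset.sum_congr rfl fun p _ => ?_
    rw [intervalIntegral.integral_finsetSum
      fun q _ => Continuous.intervalIntegrable (by fun_prop) _ _]
    refine Finset.sum_congr rfl fun q _ => ?_
    rw [intervalIntegral.integral_const_mul, integral_deriv_bern_mul_bern]
    ring
  simp only [inner]
  rw [intervalIntegral.integral_finsetSum
    fun p _ => Continuous.intervalIntegrable (by fun_prop) _ _]
  have outer : ∀ p : Fin m × Fin n, (∫ u in (0:ℝ)..1, ∑ q : Fin m × Fin n,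
        (D p.1 p.2 * D q.1 q.2 * (thetaMat n q.2 p.2 / 2)) *
          (deriv (bern m (p.1.1 + 1)) u * bern m (q.1.1 + 1) u)) =
      ∑ q : Fin m × Fin n,
        (1 / 4) * (thetaMat m p.1 q.1 * D q.1 q.2 * thetaMat n q.2 p.2 * D p.1 p.2) := by
    intro p
    rw [intervalIntegral.integral_finsetSum
      fun q _ => Continuous.intervalIntegrable (by fun_prop) _ _]
    refine Finset.sum_congr rfl fun q _ => ?_
    rw [intervalIntegral.integral_const_mul, integral_deriv_bern_mul_bern]
    ring
  simp only [outer, ← Finset.mul_sum]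
  congr 1
  simp only [Matrix.trace, Matrix.diag_apply, Matrix.mul_apply, Matrix.transpose_apply,
    Fintype.sum_prod_type, Finset.sum_mul]
  refine Finset.sum_congr rfl fun i _ => Finset.sum_congr rfl fun j _ => ?_
  exact Finset.sum_comm


/-- for a grid copula matrix `D`,
`∫_{[0,1]²} ∂₁C_B^D ∂₂C_B^D = (1/4) tr(Θ^{(m)} D Θ^{(n)} Dᵀ)` and consequently
Kendall's tau `1 − 4∫ ∂₁C ∂₂C` equals `1 − tr(Θ^{(m)} D Θ^{(n)} Dᵀ)`. -/
theorem bernstein_kendall_tau (m n : ℕ) (hm : 1 ≤ m) (hn : 1 ≤ n)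
    (D : Matrix (Fin m) (Fin n) ℝ) (hD : IsGridCopulaMatrix m n D) :
    (∫ u in (0:ℝ)..1, ∫ v in (0:ℝ)..1,
        deriv (fun x => bernCop m n D x v) u * deriv (fun y => bernCop m n D u y) v)
      = (1 / 4) * Matrix.trace (thetaMat m * D * thetaMat n * D.transpose) ∧
    1 - 4 * (∫ u in (0:ℝ)..1, ∫ v in (0:ℝ)..1,
        deriv (fun x => bernCop m n D x v) u * deriv (fun y => bernCop m n D u y) v)
      = 1 - Matrix.trace (thetaMat m * D * thetaMat n * D.transpose) := by
  have h := integral_deriv_bernCop_mul_deriv_bernCop m n D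
  refine ⟨h, ?_⟩
  rw [h]
  ring
end

section
/- Let n ≥ 1, let π be a permutation of {1,…,n} with d_i = π(i) − i, and let f_π(u) = u + d_{⌈nu⌉}/n for u ∈ (0,1]. Then ∫₀¹ u·f_π(u) du = 1/3 − (1/(2n³)) ∑_{i=1}^{n} d_i². Consequently, Spearman's rho of the straight shuffle-of-min copula C_π, given by ρ_S(C_π) = 12∫₀¹ u f_π(u) du − 3, equals 1 − 6∑_{i=1}^{n} d_i² / n³. -/
open MeasureTheory

/-- The shuffle-of-min support function `f_π(u) = u + (π(⌈nu⌉) − ⌈nu⌉)/n`. -/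
noncomputable def shuffleFun (n : ℕ) (p : ℕ → ℕ) (u : ℝ) : ℝ :=
  u + ((p ⌈(n : ℝ) * u⌉₊ : ℝ) - (⌈(n : ℝ) * u⌉₊ : ℝ)) / n

/-- On `((k-1)/n, k/n]` with `k = j + 1`, the ceiling in `shuffleFun` is constant. -/
theorem shuffleFun_eq_of_mem_Ioc {n : ℕ} (hn : 1 ≤ n) (p : ℕ → ℕ) (j : ℕ) {u : ℝ}
    (hu : u ∈ Set.Ioc ((j : ℝ) / n) (((j + 1 : ℕ) : ℝ) / n)) :
    shuffleFun n p u = u + ((p (j + 1) : ℝ) - ((j + 1 : ℕ) : ℝ)) / n := by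
  have hn0 : (0 : ℝ) < n := by exact_mod_cast hn
  have h : ⌈(n : ℝ) * u⌉₊ = j + 1 := by
    rw [Nat.ceil_eq_iff (Nat.succ_ne_zero j)]
    obtain ⟨h1, h2⟩ := hu
    rw [div_lt_iff₀ hn0] at h1
    rw [le_div_iff₀ hn0] at h2
    rw [mul_comm, Nat.succ_eq_add_one, Nat.add_sub_cancel]
    exact ⟨h1, h2⟩
  rw [shuffleFun, h]

theorem eqOn_mul_shuffleFun {n : ℕ} (hn : 1 ≤ n) (p : ℕ → ℕ) (j : ℕ) :
    Set.EqOn (fun u : ℝ => u ^ 2 + ((p (j + 1) : ℝ) - ((j + 1 : ℕ) : ℝ)) / n * u)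
      (fun u => u * shuffleFun n p u)
      (Set.uIoc ((j : ℝ) / n) (((j + 1 : ℕ) : ℝ) / n)) := by
  intro u hu
  rw [Set.uIoc_of_le (by gcongr; exact Nat.le_succ j)] at hu
  simp only [shuffleFun_eq_of_mem_Ioc hn p j hu]
  ring

theorem intervalIntegrable_mul_shuffleFun {n : ℕ} (hn : 1 ≤ n) (p : ℕ → ℕ) (j : ℕ) :
    IntervalIntegrable (fun u => u * shuffleFun n p u) volume
      ((j : ℝ) / n) (((j + 1 : ℕ) : ℝ) / n) :=
  (Continuous.intervalIntegrable (by fun_prop) _ _).congr (eqOn_mul_shuffleFun hn p j)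

theorem integral_mul_shuffleFun_piece {n : ℕ} (hn : 1 ≤ n) (p : ℕ → ℕ) (j : ℕ) :
    ∫ u in ((j : ℝ) / n)..(((j + 1 : ℕ) : ℝ) / n), u * shuffleFun n p u
      = (((j + 1 : ℕ) : ℝ) ^ 3 - (j : ℝ) ^ 3) / (3 * (n : ℝ) ^ 3)
        + ((p (j + 1) : ℝ) - ((j + 1 : ℕ) : ℝ)) * (2 * ((j + 1 : ℕ) : ℝ) - 1)
          / (2 * (n : ℝ) ^ 3) := by
  have hn0 : (n : ℝ) ≠ 0 := by positivity
  rw [← intervalIntegral.integral_congr_ae (.of_forall (eqOn_mul_shuffleFun hn p j)),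
    intervalIntegral.integral_add (Continuous.intervalIntegrable (by fun_prop) _ _)
      (Continuous.intervalIntegrable (by fun_prop) _ _),
    intervalIntegral.integral_const_mul, integral_pow, integral_id]
  push_cast
  field_simp
  ring

theorem sum_comp_of_bijOn {n : ℕ} {p : ℕ → ℕ}
    (hp : Set.BijOn p (Set.Icc 1 n) (Set.Icc 1 n)) (g : ℕ → ℝ) :
    ∑ i ∈ Finset.Icc 1 n, g (p i) = ∑ i ∈ Finset.Icc 1 n, g i := by
  rw [← Finset.coe_Icc] at hp
  exact Finset.sum_nbij p hp.mapsTo hp.injOn hp.surjOn fun _ _ => rfl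

/-- The displacements of a permutation satisfy `∑ d_i (2i - 1) = -∑ d_i²`. -/
theorem sum_displacement_mul {n : ℕ} {p : ℕ → ℕ}
    (hp : Set.BijOn p (Set.Icc 1 n) (Set.Icc 1 n)) :
    ∑ i ∈ Finset.Icc 1 n, ((p i : ℝ) - (i : ℝ)) * (2 * (i : ℝ) - 1)
      = -∑ i ∈ Finset.Icc 1 n, ((p i : ℝ) - (i : ℝ)) ^ 2 := by
  have h : ∑ i ∈ Finset.Icc 1 n, (((p i : ℝ) ^ 2 - (p i : ℝ)) - ((i : ℝ) ^ 2 - (i : ℝ))) = 0 := by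
    rw [Finset.sum_sub_distrib, sub_eq_zero]
    exact sum_comp_of_bijOn hp fun i => (i : ℝ) ^ 2 - (i : ℝ)
  rw [eq_neg_iff_add_eq_zero, ← Finset.sum_add_distrib, ← h]
  exact Finset.sum_congr rfl fun i _ => by ring

theorem integral_mul_shuffleFun {n : ℕ} (hn : 1 ≤ n) {p : ℕ → ℕ}
    (hp : Set.BijOn p (Set.Icc 1 n) (Set.Icc 1 n)) :
    (∫ u in (0:ℝ)..1, u * shuffleFun n p u)
      = 1 / 3 - (1 / (2 * (n : ℝ) ^ 3)) * ∑ i ∈ Finset.Icc 1 n, ((p i : ℝ) - (i : ℝ)) ^ 2 := by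
  have hn0 : (n : ℝ) ≠ 0 := by positivity
  have hsum := intervalIntegral.sum_integral_adjacent_intervals (μ := volume)
    (a := fun k : ℕ => (k : ℝ) / n) (n := n)
    fun k _ => intervalIntegrable_mul_shuffleFun hn p k
  simp only [Nat.cast_zero, zero_div, div_self hn0] at hsum
  have hshift : ∑ j ∈ Finset.range n,
      ((p (j + 1) : ℝ) - ((j + 1 : ℕ) : ℝ)) * (2 * ((j + 1 : ℕ) : ℝ) - 1)
        = ∑ i ∈ Finset.Icc 1 n, ((p i : ℝ) - (i : ℝ)) * (2 * (i : ℝ) - 1) := by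
    rw [Finset.range_eq_Ico,
      Finset.sum_Ico_add' (fun i : ℕ => ((p i : ℝ) - (i : ℝ)) * (2 * (i : ℝ) - 1)) 0 n 1]
    rfl
  rw [← hsum, Finset.sum_congr rfl fun j _ => integral_mul_shuffleFun_piece hn p j,
    Finset.sum_add_distrib, ← Finset.sum_div, ← Finset.sum_div,
    Finset.sum_range_sub (fun j : ℕ => (j : ℝ) ^ 3), hshift, sum_displacement_mul hp]
  field_simp
  simp
  ring

/-- for a permutation `p` of `{1,…,n}` with `d_i = p(i) − i`,
`∫₀¹ u f_π(u) du = 1/3 − (1/(2n³)) ∑ d_i²`, and consequently Spearman's rho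
`ρ_S(C_π) = 12∫₀¹ u f_π(u) du − 3` equals `1 − 6 ∑ d_i² / n³`. -/
theorem shuffle_spearman_rho (n : ℕ) (hn : 1 ≤ n) (p : ℕ → ℕ)
    (hp : Set.BijOn p (Set.Icc 1 n) (Set.Icc 1 n)) :
    (∫ u in (0:ℝ)..1, u * shuffleFun n p u)
      = 1 / 3 - (1 / (2 * (n : ℝ) ^ 3)) * ∑ i ∈ Finset.Icc 1 n, ((p i : ℝ) - (i : ℝ)) ^ 2 ∧
    12 * (∫ u in (0:ℝ)..1, u * shuffleFun n p u) - 3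
      = 1 - 6 * (∑ i ∈ Finset.Icc 1 n, ((p i : ℝ) - (i : ℝ)) ^ 2) / (n : ℝ) ^ 3 := by
  have hn0 : (n : ℝ) ≠ 0 := by positivity
  refine ⟨integral_mul_shuffleFun hn hp, ?_⟩
  rw [integral_mul_shuffleFun hn hp]
  field_simp
  ring
end

section
/- Let n ≥ 1, let π be a permutation of {1,…,n}, and let f_π(u) = u + (π(⌈nu⌉) − ⌈nu⌉)/n for u ∈ (0,1]. Then the two-dimensional Lebesgue measure of the set { (u₁,u₂) ∈ (0,1]² : (u₁ − u₂)(f_π(u₁) − f_π(u₂)) < 0 } equals 2·N_inv(π)/n², where N_inv(π) = #{(i,j) : 1 ≤ i < j ≤ n, π(i) > π(j)} is the number of inversions of π. Consequently, Kendall's tau of the straight shuffle-of-min copula C_π, being the measure of the concordance set minus the measure of this discordance set, equals 1 − 4·N_inv(π)/n². -/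
open MeasureTheory

/-- The number of inversions of the permutation `p` of `{1,…,n}`. -/
def numInversions (n : ℕ) (p : ℕ → ℕ) : ℕ :=
  ((Finset.Icc 1 n ×ˢ Finset.Icc 1 n).filter (fun q => q.1 < q.2 ∧ p q.2 < p q.1)).card

lemma natCast_mul_shuffleFun {n : ℕ} (hn : 1 ≤ n) (p : ℕ → ℕ) (u : ℝ) :
    n * shuffleFun n p u = n * u + ((p ⌈(n : ℝ) * u⌉₊ : ℝ) - (⌈(n : ℝ) * u⌉₊ : ℝ)) := by
  have : (n : ℝ) ≠ 0 := by positivity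
  unfold shuffleFun
  field_simp

lemma ceil_natCast_mul_mem_Icc {n : ℕ} (hn : 1 ≤ n) {u : ℝ} (hu : u ∈ Set.Ioc (0 : ℝ) 1) :
    ⌈(n : ℝ) * u⌉₊ ∈ Set.Icc 1 n := by
  have hn' : (0 : ℝ) < n := by positivity
  refine ⟨Nat.ceil_pos.2 (mul_pos hn' hu.1), Nat.ceil_le.2 ?_⟩
  nlinarith [hu.2]

/-- The pairs of indices in `{1,…,n}` which `p` puts in the opposite order. -/
def discordantPairs (n : ℕ) (p : ℕ → ℕ) : Finset (ℕ × ℕ) :=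
  (Finset.Icc 1 n ×ˢ Finset.Icc 1 n).filter
    (fun q => (q.1 < q.2 ∧ p q.2 < p q.1) ∨ (q.2 < q.1 ∧ p q.1 < p q.2))

lemma card_discordantPairs (n : ℕ) (p : ℕ → ℕ) :
    (discordantPairs n p).card = 2 * numInversions n p := by
  unfold discordantPairs numInversions
  rw [Finset.filter_or, Finset.card_union_of_disjoint, two_mul]
  · congr 1
    refine Finset.card_bij (fun q _ => q.swap) ?_ ?_ ?_
    · simp +contextual
    · intro a _ b _ h
      exact Prod.swap_injective h
    · intro b hb
      refine ⟨b.swap, ?_, by simp⟩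
      simp at hb ⊢
      tauto
  · rw [Finset.disjoint_filter]
    intro x _ h h'
    omega

lemma sub_mul_shuffleFun_sub_sign {n : ℕ} (hn : 1 ≤ n) {p : ℕ → ℕ}
    (hp : Set.InjOn p (Set.Icc 1 n)) {u v : ℝ} (hu : u ∈ Set.Ioc (0 : ℝ) 1)
    (hv : v ∈ Set.Ioc (0 : ℝ) 1) :
    ((u - v) * (shuffleFun n p u - shuffleFun n p v) < 0 ↔
      (⌈(n : ℝ) * u⌉₊, ⌈(n : ℝ) * v⌉₊) ∈ discordantPairs n p) ∧
    ((u - v) * (shuffleFun n p u - shuffleFun n p v) = 0 ↔ u = v) := by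
  have hn' : (0 : ℝ) < n := by positivity
  have hi := ceil_natCast_mul_mem_Icc hn hu
  have hj := ceil_natCast_mul_mem_Icc hn hv
  have hfu := natCast_mul_shuffleFun hn p u
  have hfv := natCast_mul_shuffleFun hn p v
  have hiu := Nat.le_ceil ((n : ℝ) * u)
  have hjv := Nat.le_ceil ((n : ℝ) * v)
  have hiu' := Nat.ceil_lt_add_one (mul_pos hn' hu.1).le
  have hjv' := Nat.ceil_lt_add_one (mul_pos hn' hv.1).le
  have hmem : (⌈(n : ℝ) * u⌉₊, ⌈(n : ℝ) * v⌉₊) ∈ discordantPairs n p ↔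
      (⌈(n : ℝ) * u⌉₊ < ⌈(n : ℝ) * v⌉₊ ∧ p ⌈(n : ℝ) * v⌉₊ < p ⌈(n : ℝ) * u⌉₊) ∨
      (⌈(n : ℝ) * v⌉₊ < ⌈(n : ℝ) * u⌉₊ ∧ p ⌈(n : ℝ) * u⌉₊ < p ⌈(n : ℝ) * v⌉₊) := by
    have h1 := Finset.mem_Icc.2 hi
    have h2 := Finset.mem_Icc.2 hj
    simp only [discordantPairs, Finset.mem_filter, Finset.mem_product, h1, h2, true_and]
  rw [hmem]
  have hinj : p ⌈(n : ℝ) * u⌉₊ = p ⌈(n : ℝ) * v⌉₊ → ⌈(n : ℝ) * u⌉₊ = ⌈(n : ℝ) * v⌉₊ :=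
    fun h => hp hi hj h
  generalize ⌈(n : ℝ) * u⌉₊ = i at *
  generalize ⌈(n : ℝ) * v⌉₊ = j at *
  generalize shuffleFun n p u = x at *
  generalize shuffleFun n p v = y at *
  have key : ∀ {k l : ℕ}, k < l → (k : ℝ) + 1 ≤ l := fun h => by exact_mod_cast h
  have lt_of : ∀ {a b : ℝ}, n * a < n * b → a < b := fun h => lt_of_mul_lt_mul_left h hn'.le
  rcases lt_trichotomy i j with h | h | h
  · have huv : u < v := lt_of (by linarith [key h])
    rcases lt_trichotomy (p i) (p j) with h' | h' | h'
    · have hxy : x < y := lt_of (by linarith [key h'])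
      have := mul_pos_of_neg_of_neg (sub_neg.2 huv) (sub_neg.2 hxy)
      exact ⟨iff_of_false this.not_gt (by omega), iff_of_false this.ne' huv.ne⟩
    · have := hinj h'; omega
    · have hxy : y < x := lt_of (by linarith [key h'])
      have := mul_neg_of_neg_of_pos (sub_neg.2 huv) (sub_pos.2 hxy)
      exact ⟨iff_of_true this (by omega), iff_of_false this.ne huv.ne⟩
  · subst h
    have hxy : x - y = u - v := mul_left_cancel₀ hn'.ne' (by linarith)
    rw [hxy]
    refine ⟨iff_of_false (mul_self_nonneg _).not_gt (by omega), ?_⟩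
    rw [mul_self_eq_zero, sub_eq_zero]
  · have huv : v < u := lt_of (by linarith [key h])
    rcases lt_trichotomy (p i) (p j) with h' | h' | h'
    · have hxy : x < y := lt_of (by linarith [key h'])
      have := mul_neg_of_pos_of_neg (sub_pos.2 huv) (sub_neg.2 hxy)
      exact ⟨iff_of_true this (by omega), iff_of_false this.ne huv.ne'⟩
    · have := hinj h'; omega
    · have hxy : y < x := lt_of (by linarith [key h'])
      have := mul_pos (sub_pos.2 huv) (sub_pos.2 hxy)
      exact ⟨iff_of_false this.not_gt (by omega), iff_of_false this.ne' huv.ne'⟩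

/-- The `k`-th interval `((k-1)/n, k/n]` of the uniform partition of `(0,1]`. -/
def shuffleCell (n k : ℕ) : Set ℝ := Set.Ioc (((k : ℝ) - 1) / n) ((k : ℝ) / n)

lemma mem_shuffleCell_iff {n k : ℕ} (hn : 1 ≤ n) (hk : 1 ≤ k) {u : ℝ} :
    u ∈ shuffleCell n k ↔ ⌈(n : ℝ) * u⌉₊ = k := by
  have hn' : (0 : ℝ) < n := by positivity
  rw [Nat.ceil_eq_iff (by omega), shuffleCell, Set.mem_Ioc, div_lt_iff₀ hn', le_div_iff₀ hn',
    Nat.cast_sub hk, Nat.cast_one, mul_comm u]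

lemma volume_shuffleCell_prod {n : ℕ} (hn : 1 ≤ n) (i j : ℕ) :
    volume (shuffleCell n i ×ˢ shuffleCell n j) = ENNReal.ofReal (1 / (n : ℝ) ^ 2) := by
  have hn' : (n : ℝ) ≠ 0 := by positivity
  rw [Measure.volume_eq_prod, Measure.prod_prod, shuffleCell, shuffleCell, Real.volume_Ioc,
    Real.volume_Ioc, ← sub_div, ← sub_div, sub_sub_cancel, sub_sub_cancel,
    ← ENNReal.ofReal_mul (by positivity)]
  congr 1
  field_simp

lemma volume_diagonal_real : volume (Set.diagonal ℝ) = 0 := by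
  rw [Measure.volume_eq_prod, Measure.measure_prod_null isClosed_diagonal.measurableSet]
  refine Filter.Eventually.of_forall fun x => ?_
  have : Prod.mk x ⁻¹' Set.diagonal ℝ = {x} := by
    ext y
    simp [eq_comm]
  simp [this]

lemma discordance_eq_biUnion {n : ℕ} (hn : 1 ≤ n) {p : ℕ → ℕ}
    (hp : Set.InjOn p (Set.Icc 1 n)) :
    {q : ℝ × ℝ | q.1 ∈ Set.Ioc (0:ℝ) 1 ∧ q.2 ∈ Set.Ioc (0:ℝ) 1 ∧
        (q.1 - q.2) * (shuffleFun n p q.1 - shuffleFun n p q.2) < 0} =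
      ⋃ r ∈ discordantPairs n p, shuffleCell n r.1 ×ˢ shuffleCell n r.2 := by
  have hn' : (0 : ℝ) < n := by positivity
  have hcell : ∀ {k : ℕ} {u : ℝ}, k ∈ Finset.Icc 1 n → u ∈ shuffleCell n k →
      u ∈ Set.Ioc (0 : ℝ) 1 := by
    intro k u hk hu
    rw [Finset.mem_Icc] at hk
    have h1 : (1 : ℝ) ≤ k := by exact_mod_cast hk.1
    have h2 : (k : ℝ) ≤ n := by exact_mod_cast hk.2
    exact ⟨(div_nonneg (by linarith) hn'.le).trans_lt hu.1, hu.2.trans ((div_le_one hn').2 h2)⟩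
  ext ⟨u, v⟩
  simp only [Set.mem_ofPred_eq, Set.mem_iUnion, Set.mem_prod, exists_prop]
  constructor
  · rintro ⟨hu, hv, h⟩
    exact ⟨_, (sub_mul_shuffleFun_sub_sign hn hp hu hv).1.1 h,
      (mem_shuffleCell_iff hn (ceil_natCast_mul_mem_Icc hn hu).1).2 rfl,
      (mem_shuffleCell_iff hn (ceil_natCast_mul_mem_Icc hn hv).1).2 rfl⟩
  · rintro ⟨⟨i, j⟩, hr, hui, hvj⟩
    have hij := Finset.mem_product.1 (Finset.mem_filter.1 hr).1
    have hu := hcell hij.1 hui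
    have hv := hcell hij.2 hvj
    refine ⟨hu, hv, (sub_mul_shuffleFun_sub_sign hn hp hu hv).1.2 ?_⟩
    rwa [(mem_shuffleCell_iff hn (Finset.mem_Icc.1 hij.1).1).1 hui,
      (mem_shuffleCell_iff hn (Finset.mem_Icc.1 hij.2).1).1 hvj]

lemma measurableSet_shuffleCell_prod (n i j : ℕ) :
    MeasurableSet (shuffleCell n i ×ˢ shuffleCell n j) :=
  measurableSet_Ioc.prod measurableSet_Ioc

lemma volume_discordance {n : ℕ} (hn : 1 ≤ n) (p : ℕ → ℕ) :
    volume (⋃ r ∈ discordantPairs n p, shuffleCell n r.1 ×ˢ shuffleCell n r.2) =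
      ENNReal.ofReal (2 * (numInversions n p : ℝ) / (n : ℝ) ^ 2) := by
  rw [measure_biUnion_finset _ fun r _ => measurableSet_shuffleCell_prod n r.1 r.2]
  · simp_rw [volume_shuffleCell_prod hn]
    rw [Finset.sum_const, card_discordantPairs, ← ENNReal.ofReal_nsmul, nsmul_eq_mul]
    push_cast
    rw [mul_one_div]
  · rintro ⟨i, j⟩ hr ⟨k, l⟩ hs hne
    have hij := Finset.mem_product.1 (Finset.mem_filter.1 (Finset.mem_coe.1 hr)).1
    have hkl := Finset.mem_product.1 (Finset.mem_filter.1 (Finset.mem_coe.1 hs)).1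
    refine Set.disjoint_left.2 fun q hq hq' => hne ?_
    exact Prod.ext
      (((mem_shuffleCell_iff hn (Finset.mem_Icc.1 hij.1).1).1 hq.1).symm.trans
        ((mem_shuffleCell_iff hn (Finset.mem_Icc.1 hkl.1).1).1 hq'.1))
      (((mem_shuffleCell_iff hn (Finset.mem_Icc.1 hij.2).1).1 hq.2).symm.trans
        ((mem_shuffleCell_iff hn (Finset.mem_Icc.1 hkl.2).1).1 hq'.2))

/-- the Lebesgue measure of the discordance set
`{(u₁,u₂) ∈ (0,1]² : (u₁−u₂)(f_π(u₁)−f_π(u₂)) < 0}` is `2 N_inv(π)/n²`, and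
consequently Kendall's tau of the straight shuffle-of-min copula — the measure of
the concordance set minus the measure of the discordance set — is `1 − 4 N_inv(π)/n²`. -/
theorem shuffle_kendall_tau (n : ℕ) (hn : 1 ≤ n) (p : ℕ → ℕ)
    (hp : Set.BijOn p (Set.Icc 1 n) (Set.Icc 1 n)) :
    volume {q : ℝ × ℝ | q.1 ∈ Set.Ioc (0:ℝ) 1 ∧ q.2 ∈ Set.Ioc (0:ℝ) 1 ∧
        (q.1 - q.2) * (shuffleFun n p q.1 - shuffleFun n p q.2) < 0}
      = ENNReal.ofReal (2 * (numInversions n p : ℝ) / (n : ℝ) ^ 2) ∧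
    (volume {q : ℝ × ℝ | q.1 ∈ Set.Ioc (0:ℝ) 1 ∧ q.2 ∈ Set.Ioc (0:ℝ) 1 ∧
        0 < (q.1 - q.2) * (shuffleFun n p q.1 - shuffleFun n p q.2)}).toReal -
    (volume {q : ℝ × ℝ | q.1 ∈ Set.Ioc (0:ℝ) 1 ∧ q.2 ∈ Set.Ioc (0:ℝ) 1 ∧
        (q.1 - q.2) * (shuffleFun n p q.1 - shuffleFun n p q.2) < 0}).toReal
      = 1 - 4 * (numInversions n p : ℝ) / (n : ℝ) ^ 2 := by
  set D := {q : ℝ × ℝ | q.1 ∈ Set.Ioc (0:ℝ) 1 ∧ q.2 ∈ Set.Ioc (0:ℝ) 1 ∧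
        (q.1 - q.2) * (shuffleFun n p q.1 - shuffleFun n p q.2) < 0} with hD
  have hDU := discordance_eq_biUnion hn hp.injOn
  have hDvol : volume D = ENNReal.ofReal (2 * (numInversions n p : ℝ) / (n : ℝ) ^ 2) := by
    rw [hD, hDU, volume_discordance hn]
  refine ⟨hDvol, ?_⟩
  have hDmeas : MeasurableSet D := by
    rw [hD, hDU]
    exact Finset.measurableSet_biUnion _ fun r _ => measurableSet_shuffleCell_prod n r.1 r.2
  have hDsub : D ⊆ Set.Ioc (0:ℝ) 1 ×ˢ Set.Ioc (0:ℝ) 1 := fun q hq => ⟨hq.1, hq.2.1⟩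
  have hC : {q : ℝ × ℝ | q.1 ∈ Set.Ioc (0:ℝ) 1 ∧ q.2 ∈ Set.Ioc (0:ℝ) 1 ∧
        0 < (q.1 - q.2) * (shuffleFun n p q.1 - shuffleFun n p q.2)} =
      ((Set.Ioc (0:ℝ) 1 ×ˢ Set.Ioc (0:ℝ) 1) \ D) \ Set.diagonal ℝ := by
    ext ⟨u, v⟩
    simp only [hD, Set.mem_ofPred_eq, Set.mem_sdiff, Set.mem_prod, Set.mem_diagonal_iff]
    constructor
    · rintro ⟨hu, hv, h⟩
      exact ⟨⟨⟨hu, hv⟩, fun h' => h.not_gt h'.2.2⟩,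
        fun h' => h.ne' ((sub_mul_shuffleFun_sub_sign hn hp.injOn hu hv).2.2 h')⟩
    · rintro ⟨⟨⟨hu, hv⟩, h⟩, hne⟩
      refine ⟨hu, hv, lt_of_le_of_ne (not_lt.1 fun h' => h ⟨hu, hv, h'⟩) fun h' => hne ?_⟩
      exact (sub_mul_shuffleFun_sub_sign hn hp.injOn hu hv).2.1 h'.symm
  have hsq : volume (Set.Ioc (0:ℝ) 1 ×ˢ Set.Ioc (0:ℝ) 1) = 1 := by
    simp [Measure.volume_eq_prod, Measure.prod_prod]
  have hDfin : volume D ≠ ⊤ := hDvol ▸ ENNReal.ofReal_ne_top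
  rw [hC, measure_sdiff_null volume_diagonal_real,
    measure_sdiff hDsub hDmeas.nullMeasurableSet hDfin,
    ENNReal.toReal_sub_of_le (measure_mono hDsub) (by simp [hsq]), hsq, hDvol,
    ENNReal.toReal_ofReal (by positivity), ENNReal.toReal_one]
  ring
end

section
/- Let n ≥ 1, let π be a permutation of {1,…,n}, let f_π(u) = u + (π(⌈nu⌉) − ⌈nu⌉)/n for u ∈ (0,1], and define C_π(u,v) = λ({ x ∈ (0,u] : f_π(x) ≤ v }) for (u,v) ∈ [0,1]², where λ is Lebesgue measure. Then: (i) the limit as t → 0⁺ of C_π(t,t)/t equals 1 if π(1) = 1 and equals 0 otherwise; (ii) the limit as t → 1⁻ of (1 − C_π(t,t))/(1 − t) equals 1 if π(n) = n and equals 2 otherwise. In particular, the lower and upper tail dependence coefficients of the straight shuffle-of-min copula C_π are λ_L(C_π) = 1_{{π(1)=1}} and λ_U(C_π) = 1_{{π(n)=n}}. -/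
open MeasureTheory Filter

/-- The straight shuffle-of-min copula `C_π(u,v) = λ({x ∈ (0,u] : f_π(x) ≤ v})`. -/
noncomputable def shuffleCop (n : ℕ) (p : ℕ → ℕ) (u v : ℝ) : ℝ :=
  (volume {x : ℝ | x ∈ Set.Ioc 0 u ∧ shuffleFun n p x ≤ v}).toReal

/-- The defining inequality of the shuffle-of-min, with denominators cleared. -/
lemma shuffleFun_le_iff {n : ℕ} (hn : 1 ≤ n) (p : ℕ → ℕ) (x t : ℝ) :
    shuffleFun n p x ≤ t ↔
      n * x + p ⌈(n : ℝ) * x⌉₊ - ⌈(n : ℝ) * x⌉₊ ≤ n * t := by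
  have hN : (0 : ℝ) < n := by exact_mod_cast hn
  have h : shuffleFun n p x =
      (n * x + p ⌈(n : ℝ) * x⌉₊ - ⌈(n : ℝ) * x⌉₊) / n := by
    unfold shuffleFun
    field_simp
    ring
  rw [h, div_le_iff₀ hN, mul_comm t]

/-- For `x ∈ (0,1]`, the index `⌈nx⌉` lies in `{1,…,n}`. -/
lemma ceil_mul_mem_Icc {n : ℕ} (hn : 1 ≤ n) {x : ℝ} (hx0 : 0 < x) (hx1 : x ≤ 1) :
    ⌈(n : ℝ) * x⌉₊ ∈ Set.Icc 1 n := by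
  have hN : (0 : ℝ) < n := by exact_mod_cast hn
  exact ⟨Nat.one_le_ceil_iff.2 (by positivity), Nat.ceil_le.2 (by nlinarith)⟩

/-- Strips whose image is not the top strip stay below `t > 1 - 1/n`. -/
lemma shuffleFun_le_of_apply_ne {n : ℕ} (hn : 1 ≤ n) {p : ℕ → ℕ}
    (hp : Set.MapsTo p (Set.Icc 1 n) (Set.Icc 1 n)) {x t : ℝ} (hx0 : 0 < x) (hx1 : x ≤ 1)
    (ht : (n : ℝ) - 1 < n * t) (h : p ⌈(n : ℝ) * x⌉₊ ≠ n) : shuffleFun n p x ≤ t := by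
  rw [shuffleFun_le_iff hn]
  have hle := (hp (ceil_mul_mem_Icc hn hx0 hx1)).2
  have h1 : (p ⌈(n : ℝ) * x⌉₊ : ℝ) + 1 ≤ n := by
    exact_mod_cast Nat.succ_le_of_lt (lt_of_le_of_ne hle h)
  have h2 := Nat.le_ceil ((n : ℝ) * x)
  linarith

lemma shuffleCop_diag_of_apply_one_eq {n : ℕ} (hn : 1 ≤ n) {p : ℕ → ℕ} (h1 : p 1 = 1)
    {t : ℝ} (ht0 : 0 < t) (ht : n * t ≤ 1) : shuffleCop n p t t = t := by
  have hN : (0 : ℝ) < n := by exact_mod_cast hn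
  have hset : {x : ℝ | x ∈ Set.Ioc 0 t ∧ shuffleFun n p x ≤ t} = Set.Ioc 0 t := by
    ext x
    refine ⟨fun h => h.1, fun hx => ⟨hx, ?_⟩⟩
    have hc : ⌈(n : ℝ) * x⌉₊ = 1 := le_antisymm
      (Nat.ceil_le.2 (by push_cast; nlinarith [hx.2]))
      (Nat.one_le_ceil_iff.2 (mul_pos hN hx.1))
    rw [shuffleFun_le_iff hn, hc, h1]
    nlinarith [hx.2]
  rw [shuffleCop, hset, Real.volume_Ioc, ENNReal.toReal_ofReal (by linarith)]
  ring

lemma shuffleCop_diag_of_two_le_apply_one {n : ℕ} (hn : 1 ≤ n) {p : ℕ → ℕ} (h1 : 2 ≤ p 1)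
    {t : ℝ} (ht : n * t ≤ 1) : shuffleCop n p t t = 0 := by
  have hN : (0 : ℝ) < n := by exact_mod_cast hn
  have hset : {x : ℝ | x ∈ Set.Ioc 0 t ∧ shuffleFun n p x ≤ t} = ∅ := by
    refine Set.eq_empty_of_forall_notMem ?_
    rintro x ⟨hx, hle⟩
    have hc : ⌈(n : ℝ) * x⌉₊ = 1 := le_antisymm
      (Nat.ceil_le.2 (by push_cast; nlinarith [hx.2]))
      (Nat.one_le_ceil_iff.2 (mul_pos hN hx.1))
    rw [shuffleFun_le_iff hn, hc] at hle
    have h2 : (2 : ℝ) ≤ p 1 := by exact_mod_cast h1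
    push_cast at hle
    linarith [mul_pos hN hx.1]
  rw [shuffleCop, hset, measure_empty, ENNReal.toReal_zero]

lemma shuffleCop_diag_of_apply_last_eq {n : ℕ} (hn : 1 ≤ n) {p : ℕ → ℕ}
    (hp : Set.BijOn p (Set.Icc 1 n) (Set.Icc 1 n)) (h : p n = n)
    {t : ℝ} (ht0 : 0 < t) (ht1 : t ≤ 1) (ht : (n : ℝ) - 1 < n * t) :
    shuffleCop n p t t = t := by
  have hset : {x : ℝ | x ∈ Set.Ioc 0 t ∧ shuffleFun n p x ≤ t} = Set.Ioc 0 t := by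
    ext x
    refine ⟨fun h => h.1, fun hx => ⟨hx, ?_⟩⟩
    have hx1 : x ≤ 1 := hx.2.trans ht1
    by_cases hc : p ⌈(n : ℝ) * x⌉₊ = n
    · have hcn : ⌈(n : ℝ) * x⌉₊ = n :=
        hp.injOn (ceil_mul_mem_Icc hn hx.1 hx1) ⟨hn, le_rfl⟩ (hc.trans h.symm)
      rw [shuffleFun_le_iff hn, hcn, h]
      nlinarith [hx.2, (Nat.cast_nonneg n : (0 : ℝ) ≤ n)]
    · exact shuffleFun_le_of_apply_ne hn hp.mapsTo hx.1 hx1 ht hc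
  rw [shuffleCop, hset, Real.volume_Ioc, ENNReal.toReal_ofReal (by linarith)]
  ring

lemma shuffleCop_diag_of_apply_last_ne {n : ℕ} (hn : 1 ≤ n) {p : ℕ → ℕ}
    (hp : Set.BijOn p (Set.Icc 1 n) (Set.Icc 1 n)) (h : p n ≠ n)
    {t : ℝ} (ht0 : 0 < t) (ht1 : t ≤ 1) (ht : (n : ℝ) - 1 < n * t) :
    shuffleCop n p t t = 2 * t - 1 := by
  have hN : (0 : ℝ) < n := by exact_mod_cast hn
  obtain ⟨k, ⟨hk1, hkn⟩, hk⟩ := hp.surjOn (show n ∈ Set.Icc 1 n from ⟨hn, le_rfl⟩)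
  have hk1' : (1 : ℝ) ≤ k := by exact_mod_cast hk1
  have hkn' : (k : ℝ) + 1 ≤ n := by
    have : k ≠ n := by rintro rfl; exact h hk
    exact_mod_cast Nat.succ_le_of_lt (lt_of_le_of_ne hkn this)
  have hdiv : (n : ℝ) * (k / n) = k := by field_simp
  have hset : {x : ℝ | x ∈ Set.Ioc 0 t ∧ shuffleFun n p x ≤ t} =
      Set.Ioc 0 t \ Set.Ioc (t - 1 + k / n) (k / n) := by
    ext x
    refine and_congr_right fun hx => ?_
    have hx1 : x ≤ 1 := hx.2.trans ht1
    have hmem := ceil_mul_mem_Icc hn hx.1 hx1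
    by_cases hc : ⌈(n : ℝ) * x⌉₊ = k
    · have hxk : x ≤ k / n := by
        rw [le_div_iff₀ hN, mul_comm, ← hc]
        exact Nat.le_ceil _
      rw [shuffleFun_le_iff hn, hc, hk]
      constructor
      · rintro hle ⟨hlt, -⟩
        nlinarith
      · intro hnot
        have hle : x ≤ t - 1 + k / n := not_lt.1 fun hlt => hnot ⟨hlt, hxk⟩
        nlinarith
    · refine iff_of_true (shuffleFun_le_of_apply_ne hn hp.mapsTo hx.1 hx1 ht fun hpc =>
        hc (hp.injOn hmem ⟨hk1, hkn⟩ (hpc.trans hk.symm))) ?_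
      rintro ⟨hlt, hle⟩
      refine hc ((Nat.ceil_eq_iff (by omega)).2 ⟨?_, ?_⟩)
      · rw [Nat.cast_sub hk1]
        push_cast
        nlinarith
      · nlinarith
  have hsub : Set.Ioc (t - 1 + k / n) (k / n) ⊆ Set.Ioc 0 t := by
    refine Set.Ioc_subset_Ioc ?_ ?_
    · by_contra! hneg
      nlinarith
    · rw [div_le_iff₀ hN]
      linarith
  rw [shuffleCop, hset, ← measureReal_def,
    measureReal_sdiff hsub measurableSet_Ioc measure_Ioc_lt_top.ne,
    Real.volume_real_Ioc_of_le ht0.le, Real.volume_real_Ioc_of_le (by linarith)]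
  ring

/-- (i) `lim_{t→0⁺} C_π(t,t)/t = 1` if `π(1)=1` and `0` otherwise;
(ii) `lim_{t→1⁻} (1−C_π(t,t))/(1−t) = 1` if `π(n)=n` and `2` otherwise.
In particular `λ_L(C_π) = 1_{π(1)=1}` and `λ_U(C_π) = 1_{π(n)=n}`. -/
theorem shuffle_tail_dependence (n : ℕ) (hn : 1 ≤ n) (p : ℕ → ℕ)
    (hp : Set.BijOn p (Set.Icc 1 n) (Set.Icc 1 n)) :
    Tendsto (fun t => shuffleCop n p t t / t) (nhdsWithin 0 (Set.Ioi 0))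
      (nhds (if p 1 = 1 then (1:ℝ) else 0)) ∧
    Tendsto (fun t => (1 - shuffleCop n p t t) / (1 - t)) (nhdsWithin 1 (Set.Iio 1))
      (nhds (if p n = n then (1:ℝ) else 2)) := by
  have hN : (0 : ℝ) < n := by exact_mod_cast hn
  constructor
  · refine tendsto_const_nhds.congr' ?_
    filter_upwards [Ioo_mem_nhdsGT (show (0 : ℝ) < 1 / n by positivity)] with t ht
    have hnt : n * t ≤ 1 := by
      have := (lt_div_iff₀ hN).1 ht.2
      linarith
    split_ifs with h1
    · rw [shuffleCop_diag_of_apply_one_eq hn h1 ht.1 hnt, div_self ht.1.ne']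
    · have h2 : 2 ≤ p 1 := by
        have := (hp.mapsTo (show 1 ∈ Set.Icc 1 n from ⟨le_rfl, hn⟩)).1
        omega
      rw [shuffleCop_diag_of_two_le_apply_one hn h2 hnt, zero_div]
  · refine tendsto_const_nhds.congr' ?_
    have hlt : ((n : ℝ) - 1) / n < 1 := by
      rw [div_lt_one hN]
      linarith
    filter_upwards [Ioo_mem_nhdsLT hlt] with t ht
    have hnt : (n : ℝ) - 1 < n * t := by
      have := (div_lt_iff₀ hN).1 ht.1
      linarith
    have ht0 : 0 < t := by
      refine lt_of_le_of_lt (div_nonneg ?_ hN.le) ht.1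
      exact sub_nonneg.2 (by exact_mod_cast hn)
    have hne : 1 - t ≠ 0 := (sub_pos.2 ht.2).ne'
    split_ifs with h
    · rw [shuffleCop_diag_of_apply_last_eq hn hp h ht0 ht.2.le hnt, div_self hne]
    · rw [shuffleCop_diag_of_apply_last_ne hn hp h ht0 ht.2.le hnt, eq_div_iff hne]
      ring
end

section
/- Let m, n ≥ 1 and let Δ be an m×n checkerboard matrix with associated checkerboard copula C_Π^Δ. Then ∫_{[0,1]²} C_Π^Δ(u,v) du dv = ∑_{i=1}^{m} ∑_{j=1}^{n} (2m−2i+1)(2n−2j+1) Δ_{i,j} / (4mn). Consequently, Spearman's rho ρ_S(C_Π^Δ) = 12 ∫_{[0,1]²} C_Π^Δ dλ² − 3 equals 3 ∑_{i,j} (2m−2i+1)(2n−2j+1) Δ_{i,j} / (mn) − 3. -/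
open MeasureTheory Finset

/-- `Δ` is an m×n checkerboard matrix: nonnegative entries, column sums `1/n`,
row sums `1/m`. -/
def IsCheckerboard (m n : ℕ) (Δ : Matrix (Fin m) (Fin n) ℝ) : Prop :=
  (∀ i j, 0 ≤ Δ i j) ∧ (∀ j, ∑ i, Δ i j = 1 / n) ∧ (∀ i, ∑ j, Δ i j = 1 / m)

/-- Entry access with natural-number (0-based) indices, `0` out of range. -/
noncomputable def cbEntry (m n : ℕ) (Δ : Matrix (Fin m) (Fin n) ℝ) (k l : ℕ) : ℝ :=
  if h : k < m ∧ l < n then Δ ⟨k, h.1⟩ ⟨l, h.2⟩ else 0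

/-- The (0-based) cell index of `u`: `⌊mu⌋`, clamped to `m−1` (so that `u = 1`
belongs to the last cell, realizing the extension with `i = m`). -/
noncomputable def cbIdx (m : ℕ) (u : ℝ) : ℕ := min ⌊(m : ℝ) * u⌋₊ (m - 1)

/-- The checkerboard copula `C_Π^Δ` (0-based cell indices `i = cbIdx m u`,
`j = cbIdx n v`, corresponding to the 1-based formula of the paper). -/
noncomputable def checkPi (m n : ℕ) (Δ : Matrix (Fin m) (Fin n) ℝ) (u v : ℝ) : ℝ :=
  (∑ k ∈ Finset.range (cbIdx m u), ∑ l ∈ Finset.range (cbIdx n v), cbEntry m n Δ k l)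
  + ((n : ℝ) * v - cbIdx n v) * ∑ k ∈ Finset.range (cbIdx m u), cbEntry m n Δ k (cbIdx n v)
  + ((m : ℝ) * u - cbIdx m u) * ∑ l ∈ Finset.range (cbIdx n v), cbEntry m n Δ (cbIdx m u) l
  + cbEntry m n Δ (cbIdx m u) (cbIdx n v) * ((m : ℝ) * u - cbIdx m u) * ((n : ℝ) * v - cbIdx n v)

/-- The truncation of `x` to the unit interval. -/
noncomputable def unitClamp (x : ℝ) : ℝ := max 0 (min 1 x)

theorem continuous_unitClamp : Continuous unitClamp := by
  unfold unitClamp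
  fun_prop

theorem unitClamp_of_nonpos {x : ℝ} (hx : x ≤ 0) : unitClamp x = 0 := by
  rw [unitClamp, min_eq_right (by linarith), max_eq_left hx]

theorem unitClamp_of_mem {x : ℝ} (h0 : 0 ≤ x) (h1 : x ≤ 1) : unitClamp x = x := by
  rw [unitClamp, min_eq_right h1, max_eq_right h0]

theorem unitClamp_of_one_le {x : ℝ} (hx : 1 ≤ x) : unitClamp x = 1 := by
  rw [unitClamp, min_eq_left hx, max_eq_right zero_le_one]

theorem integral_unitClamp {a b : ℝ} (ha : a ≤ 0) (hb : 1 ≤ b) :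
    ∫ x in a..b, unitClamp x = b - 1 / 2 := by
  have hi (c d : ℝ) : IntervalIntegrable unitClamp volume c d :=
    continuous_unitClamp.intervalIntegrable c d
  have h1 : ∫ x in a..0, unitClamp x = ∫ _ in a..0, (0 : ℝ) := by
    refine intervalIntegral.integral_congr fun x hx => ?_
    rw [Set.uIcc_of_le ha] at hx
    exact unitClamp_of_nonpos hx.2
  have h2 : ∫ x in (0 : ℝ)..1, unitClamp x = ∫ x in (0 : ℝ)..1, x := by
    refine intervalIntegral.integral_congr fun x hx => ?_
    rw [Set.uIcc_of_le zero_le_one] at hx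
    exact unitClamp_of_mem hx.1 hx.2
  have h3 : ∫ x in 1..b, unitClamp x = ∫ _ in 1..b, (1 : ℝ) := by
    refine intervalIntegral.integral_congr fun x hx => ?_
    rw [Set.uIcc_of_le hb] at hx
    exact unitClamp_of_one_le hx.1
  rw [← intervalIntegral.integral_add_adjacent_intervals (hi a 1) (hi 1 b),
    ← intervalIntegral.integral_add_adjacent_intervals (hi a 0) (hi 0 1), h1, h2, h3]
  simp only [intervalIntegral.integral_const, integral_id, smul_eq_mul]
  ring

theorem integral_unitClamp_mul_sub {m i : ℕ} (hi : i < m) :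
    ∫ u in (0 : ℝ)..1, unitClamp (m * u - i) = (2 * m - 2 * (i + 1) + 1) / (2 * m) := by
  have hm : (m : ℝ) ≠ 0 := by
    have : m ≠ 0 := by omega
    exact_mod_cast this
  have hi' : (i : ℝ) + 1 ≤ m := by exact_mod_cast hi
  rw [intervalIntegral.integral_comp_mul_sub unitClamp hm,
    integral_unitClamp (by simp) (by linarith), smul_eq_mul]
  field_simp
  ring

theorem cbIdx_lt {m : ℕ} (hm : 1 ≤ m) (u : ℝ) : cbIdx m u < m := by
  unfold cbIdx
  omega

theorem cbIdx_le {m : ℕ} {u : ℝ} (hu : 0 ≤ u) : (cbIdx m u : ℝ) ≤ m * u :=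
  (Nat.cast_le.mpr (min_le_left _ _)).trans (Nat.floor_le (by positivity))

theorem le_cbIdx_add_one {m : ℕ} (hm : 1 ≤ m) {u : ℝ} (hu : u ≤ 1) :
    (m : ℝ) * u ≤ cbIdx m u + 1 := by
  unfold cbIdx
  rcases min_choice ⌊(m : ℝ) * u⌋₊ (m - 1) with h | h <;> rw [h]
  · exact (Nat.lt_floor_add_one _).le
  · rw [Nat.cast_sub hm]
    have : (m : ℝ) * u ≤ m := mul_le_of_le_one_right (Nat.cast_nonneg m) hu
    push_cast
    linarith

/-- Summation against the clamped weights keeps the cells before that of `u`, and the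
covered fraction of the cell of `u`. -/
theorem sum_mul_unitClamp {m : ℕ} (hm : 1 ≤ m) {u : ℝ} (hu0 : 0 ≤ u) (hu1 : u ≤ 1)
    (f : ℕ → ℝ) :
    ∑ k ∈ range m, f k * unitClamp (m * u - k)
      = ∑ k ∈ range (cbIdx m u), f k + f (cbIdx m u) * (m * u - cbIdx m u) := by
  have hlo := cbIdx_le (m := m) hu0
  have hhi := le_cbIdx_add_one hm hu1
  rw [← sum_subset (range_subset_range.mpr (cbIdx_lt hm u)), sum_range_succ]
  · congr 1
    · refine sum_congr rfl fun k hk => ?_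
      have : (k : ℝ) + 1 ≤ cbIdx m u := by exact_mod_cast mem_range.mp hk
      rw [unitClamp_of_one_le (by linarith), mul_one]
    · rw [unitClamp_of_mem (by linarith) (by linarith)]
  · intro k _ hk
    have : (cbIdx m u : ℝ) + 1 ≤ k := by
      rw [mem_range, not_lt] at hk
      exact_mod_cast hk
    rw [unitClamp_of_nonpos (by linarith), mul_zero]

theorem checkPi_eq_sum {m n : ℕ} (hm : 1 ≤ m) (hn : 1 ≤ n) (Δ : Matrix (Fin m) (Fin n) ℝ)
    {u v : ℝ} (hu : u ∈ Set.Icc (0 : ℝ) 1) (hv : v ∈ Set.Icc (0 : ℝ) 1) :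
    checkPi m n Δ u v
      = ∑ i : Fin m, ∑ j : Fin n,
          Δ i j * (unitClamp (n * v - (j : ℕ)) * unitClamp (m * u - (i : ℕ))) := by
  have key : checkPi m n Δ u v = ∑ k ∈ range m,
      (∑ l ∈ range n, cbEntry m n Δ k l * unitClamp (n * v - l)) * unitClamp (m * u - k) := by
    rw [sum_mul_unitClamp hm hu.1 hu.2]
    simp only [sum_mul_unitClamp hn hv.1 hv.2, sum_add_distrib, ← sum_mul]
    unfold checkPi
    ring
  rw [key, sum_range]
  refine sum_congr rfl fun i _ => ?_
  rw [sum_range, sum_mul]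
  refine sum_congr rfl fun j _ => ?_
  rw [cbEntry, dif_pos ⟨i.2, j.2⟩, mul_assoc]

theorem integral_checkPi {m n : ℕ} (hm : 1 ≤ m) (hn : 1 ≤ n) (Δ : Matrix (Fin m) (Fin n) ℝ) :
    ∫ u in (0 : ℝ)..1, ∫ v in (0 : ℝ)..1, checkPi m n Δ u v
      = ∑ i : Fin m, ∑ j : Fin n,
          (2 * (m : ℝ) - 2 * ((i.1 : ℝ) + 1) + 1) * (2 * (n : ℝ) - 2 * ((j.1 : ℝ) + 1) + 1) *
            Δ i j / (4 * (m : ℝ) * n) := by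
  have hc (p i : ℕ) : Continuous fun x : ℝ => unitClamp (p * x - i) :=
    continuous_unitClamp.comp (by fun_prop)
  have inner (u : ℝ) (hu : u ∈ Set.Icc (0 : ℝ) 1) :
      ∫ v in (0 : ℝ)..1, checkPi m n Δ u v = ∑ i : Fin m, ∑ j : Fin n,
        Δ i j * ((2 * n - 2 * ((j : ℕ) + 1) + 1) / (2 * n) * unitClamp (m * u - (i : ℕ))) := by
    rw [intervalIntegral.integral_congr (g := fun v => ∑ i : Fin m, ∑ j : Fin n,
      Δ i j * (unitClamp (n * v - (j : ℕ)) * unitClamp (m * u - (i : ℕ))))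
      fun v hv => checkPi_eq_sum hm hn Δ hu (by rwa [Set.uIcc_of_le zero_le_one] at hv)]
    have hjc (i : Fin m) (j : Fin n) : Continuous fun v : ℝ =>
        Δ i j * (unitClamp (n * v - (j : ℕ)) * unitClamp (m * u - (i : ℕ))) :=
      continuous_const.mul ((hc n j).mul continuous_const)
    rw [intervalIntegral.integral_finsetSum fun i _ =>
      (continuous_finsetSum _ fun j _ => hjc i j).intervalIntegrable _ _]
    refine sum_congr rfl fun i _ => ?_
    rw [intervalIntegral.integral_finsetSum fun j _ => (hjc i j).intervalIntegrable _ _]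
    refine sum_congr rfl fun j _ => ?_
    rw [intervalIntegral.integral_const_mul, intervalIntegral.integral_mul_const,
      integral_unitClamp_mul_sub j.2]
  rw [intervalIntegral.integral_congr
    fun u hu => inner u (by rwa [Set.uIcc_of_le zero_le_one] at hu)]
  have hic (i : Fin m) (j : Fin n) : Continuous fun u : ℝ =>
      Δ i j * ((2 * n - 2 * ((j : ℕ) + 1) + 1) / (2 * n) * unitClamp (m * u - (i : ℕ))) :=
    continuous_const.mul (continuous_const.mul (hc m i))
  rw [intervalIntegral.integral_finsetSum fun i _ =>
    (continuous_finsetSum _ fun j _ => hic i j).intervalIntegrable _ _]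
  refine sum_congr rfl fun i _ => ?_
  rw [intervalIntegral.integral_finsetSum fun j _ => (hic i j).intervalIntegrable _ _]
  refine sum_congr rfl fun j _ => ?_
  rw [intervalIntegral.integral_const_mul, intervalIntegral.integral_const_mul,
    integral_unitClamp_mul_sub i.2]
  have hm' : (m : ℝ) ≠ 0 := by positivity
  have hn' : (n : ℝ) ≠ 0 := by positivity
  field_simp
  ring

/-- `∫_{[0,1]²} C_Π^Δ = ∑ᵢⱼ (2m−2i+1)(2n−2j+1) Δᵢⱼ/(4mn)`, and
consequently `ρ_S(C_Π^Δ) = 12∫ C_Π^Δ − 3 = 3∑ᵢⱼ (2m−2i+1)(2n−2j+1) Δᵢⱼ/(mn) − 3`. -/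
theorem checkerboard_spearman_rho (m n : ℕ) (hm : 1 ≤ m) (hn : 1 ≤ n)
    (Δ : Matrix (Fin m) (Fin n) ℝ) (hΔ : IsCheckerboard m n Δ) :
    (∫ u in (0:ℝ)..1, ∫ v in (0:ℝ)..1, checkPi m n Δ u v)
      = ∑ i : Fin m, ∑ j : Fin n,
          (2 * (m : ℝ) - 2 * ((i.1 : ℝ) + 1) + 1) * (2 * (n : ℝ) - 2 * ((j.1 : ℝ) + 1) + 1) *
            Δ i j / (4 * (m : ℝ) * n) ∧
    12 * (∫ u in (0:ℝ)..1, ∫ v in (0:ℝ)..1, checkPi m n Δ u v) - 3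
      = 3 * (∑ i : Fin m, ∑ j : Fin n,
          (2 * (m : ℝ) - 2 * ((i.1 : ℝ) + 1) + 1) * (2 * (n : ℝ) - 2 * ((j.1 : ℝ) + 1) + 1) *
            Δ i j) / ((m : ℝ) * n) - 3 := by
  refine ⟨integral_checkPi hm hn Δ, ?_⟩
  rw [integral_checkPi hm hn Δ]
  simp only [← sum_div]
  have hm' : (m : ℝ) ≠ 0 := by positivity
  have hn' : (n : ℝ) ≠ 0 := by positivity
  field_simp
  ring
end

section
/- Let m, n ≥ 1 and let Δ be an m×n checkerboard matrix with associated checkerboard copula C_Π^Δ and check–min copula C_↗^Δ. Then ∫_{[0,1]²} ( C_↗^Δ(u,v) − C_Π^Δ(u,v) ) du dv = 1/(12mn). Consequently, Spearman's rho satisfies ρ_S(C_↗^Δ) = ρ_S(C_Π^Δ) + 1/(mn), where ρ_S(C) = 12∫_{[0,1]²} C dλ² − 3. -/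
open MeasureTheory Finset

/-- The check–min copula `C_↗^Δ`, with the last term of the checkerboard formula
replaced by `Δᵢⱼ · min{nv−j+1, mu−i+1}`. -/
noncomputable def checkMin (m n : ℕ) (Δ : Matrix (Fin m) (Fin n) ℝ) (u v : ℝ) : ℝ :=
  (∑ k ∈ Finset.range (cbIdx m u), ∑ l ∈ Finset.range (cbIdx n v), cbEntry m n Δ k l)
  + ((n : ℝ) * v - cbIdx n v) * ∑ k ∈ Finset.range (cbIdx m u), cbEntry m n Δ k (cbIdx n v)
  + ((m : ℝ) * u - cbIdx m u) * ∑ l ∈ Finset.range (cbIdx n v), cbEntry m n Δ (cbIdx m u) l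
  + cbEntry m n Δ (cbIdx m u) (cbIdx n v) *
      min ((n : ℝ) * v - cbIdx n v) ((m : ℝ) * u - cbIdx m u)

lemma cbIdx_eq_of_mem_Ioo {m k : ℕ} (hk : k < m) {u : ℝ}
    (hu : u ∈ Set.Ioo ((k : ℝ) / m) ((k + 1 : ℕ) / m)) : cbIdx m u = k := by
  have hm : (0 : ℝ) < m := by exact_mod_cast (Nat.zero_le k).trans_lt hk
  have h1 := (div_lt_iff₀' hm).1 hu.1
  have h2 := (lt_div_iff₀' hm).1 hu.2
  have hfloor : ⌊(m : ℝ) * u⌋₊ = k := by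
    rw [Nat.floor_eq_iff (by linarith [(Nat.cast_nonneg k : (0:ℝ) ≤ k)])]
    exact ⟨h1.le, by exact_mod_cast h2⟩
  rw [cbIdx, hfloor]
  omega

lemma intervalIntegral_cell {m k : ℕ} (hk : k < m) (F : ℕ → ℝ → ℝ) :
    ∫ u in ((k : ℝ) / m)..((k + 1 : ℕ) / m), F (cbIdx m u) (m * u - cbIdx m u)
      = 1 / m * ∫ s in (0 : ℝ)..1, F k s := by
  have hm : (m : ℝ) ≠ 0 := by exact_mod_cast ((Nat.zero_le k).trans_lt hk).ne'
  have hle : (k : ℝ) / m ≤ (k + 1 : ℕ) / m := by gcongr; simp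
  rw [intervalIntegral.integral_of_le hle, integral_Ioc_eq_integral_Ioo,
    setIntegral_congr_fun (g := fun u => F k (m * u - k)) measurableSet_Ioo
      (fun u hu => by simp only [cbIdx_eq_of_mem_Ioo hk hu]),
    ← integral_Ioc_eq_integral_Ioo, ← intervalIntegral.integral_of_le hle,
    intervalIntegral.integral_comp_mul_sub (F k) hm]
  rw [mul_div_cancel₀ _ hm, mul_div_cancel₀ _ hm]
  simp

lemma intervalIntegrable_cell {m k : ℕ} (hk : k < m) {F : ℕ → ℝ → ℝ}
    (hF : ∀ k, Continuous (F k)) :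
    IntervalIntegrable (fun u => F (cbIdx m u) (m * u - cbIdx m u)) volume
      ((k : ℝ) / m) ((k + 1 : ℕ) / m) := by
  have hle : (k : ℝ) / m ≤ (k + 1 : ℕ) / m := by gcongr; simp
  have hc : Continuous fun u : ℝ => F k (m * u - k) := (hF k).comp (by fun_prop)
  have hi := hc.intervalIntegrable (μ := volume) ((k : ℝ) / m) ((k + 1 : ℕ) / m)
  rw [intervalIntegrable_iff_integrableOn_Ioo_of_le hle] at hi ⊢
  exact hi.congr_fun (fun u hu => by simp only [cbIdx_eq_of_mem_Ioo hk hu]) measurableSet_Ioo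

lemma intervalIntegrable_cbIdx {m : ℕ} (hm : 1 ≤ m) {F : ℕ → ℝ → ℝ}
    (hF : ∀ k, Continuous (F k)) :
    IntervalIntegrable (fun u => F (cbIdx m u) (m * u - cbIdx m u)) volume 0 1 := by
  have h := IntervalIntegrable.trans_iterate (a := fun k : ℕ => (k : ℝ) / m) (n := m)
    (fun k hk => intervalIntegrable_cell hk hF)
  have hm' : (m : ℝ) ≠ 0 := by positivity
  simpa [hm'] using h

/-- Integrating a function of the cell index and the rescaled position inside the cell. -/
lemma intervalIntegral_cbIdx {m : ℕ} (hm : 1 ≤ m) {F : ℕ → ℝ → ℝ}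
    (hF : ∀ k, Continuous (F k)) :
    ∫ u in (0 : ℝ)..1, F (cbIdx m u) (m * u - cbIdx m u)
      = ∑ k ∈ range m, 1 / m * ∫ s in (0 : ℝ)..1, F k s := by
  have h := intervalIntegral.sum_integral_adjacent_intervals
    (a := fun k : ℕ => (k : ℝ) / m) (n := m) (fun k hk => intervalIntegrable_cell hk hF)
  have hm' : (m : ℝ) ≠ 0 := by positivity
  simp only [Nat.cast_zero, zero_div, div_self hm'] at h
  rw [← h]
  exact sum_congr rfl fun k hk => intervalIntegral_cell (mem_range.1 hk) F

section TwoDim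

variable {m n : ℕ} {H : ℕ → ℕ → ℝ → ℝ → ℝ}

lemma intervalIntegral_cbIdx_snd (hn : 1 ≤ n)
    (hH : ∀ k l, Continuous (Function.uncurry (H k l))) (k : ℕ) (s : ℝ) :
    ∫ v in (0 : ℝ)..1, H k (cbIdx n v) s (n * v - cbIdx n v)
      = ∑ l ∈ range n, 1 / n * ∫ t in (0 : ℝ)..1, H k l s t :=
  intervalIntegral_cbIdx hn (F := fun l t => H k l s t)
    fun l => (hH k l).comp (by fun_prop : Continuous fun t : ℝ => (s, t))

lemma continuous_sum_intervalIntegral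
    (hH : ∀ k l, Continuous (Function.uncurry (H k l))) (k : ℕ) :
    Continuous fun s => ∑ l ∈ range n, 1 / (n : ℝ) * ∫ t in (0 : ℝ)..1, H k l s t :=
  continuous_finsetSum _ fun l _ => continuous_const.mul
    (intervalIntegral.continuous_parametric_intervalIntegral_of_continuous' (hH k l) 0 1)

lemma intervalIntegrable_intervalIntegral_cbIdx (hm : 1 ≤ m) (hn : 1 ≤ n)
    (hH : ∀ k l, Continuous (Function.uncurry (H k l))) :
    IntervalIntegrable (fun u => ∫ v in (0 : ℝ)..1,
      H (cbIdx m u) (cbIdx n v) (m * u - cbIdx m u) (n * v - cbIdx n v)) volume 0 1 := by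
  simp only [intervalIntegral_cbIdx_snd hn hH]
  exact intervalIntegrable_cbIdx hm (continuous_sum_intervalIntegral hH)

lemma intervalIntegral_intervalIntegral_cbIdx (hm : 1 ≤ m) (hn : 1 ≤ n)
    (hH : ∀ k l, Continuous (Function.uncurry (H k l))) :
    ∫ u in (0 : ℝ)..1, ∫ v in (0 : ℝ)..1,
        H (cbIdx m u) (cbIdx n v) (m * u - cbIdx m u) (n * v - cbIdx n v)
      = ∑ k ∈ range m, 1 / m * ∫ s in (0 : ℝ)..1,
          ∑ l ∈ range n, 1 / n * ∫ t in (0 : ℝ)..1, H k l s t := by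
  simp only [intervalIntegral_cbIdx_snd hn hH]
  exact intervalIntegral_cbIdx hm (continuous_sum_intervalIntegral hH)

end TwoDim

lemma intervalIntegral_min_sub_mul {s : ℝ} (hs : s ∈ Set.Icc (0 : ℝ) 1) :
    ∫ t in (0 : ℝ)..1, (min t s - s * t) = s / 2 - s ^ 2 / 2 := by
  have hc : Continuous fun t : ℝ => min t s := by fun_prop
  have hmin : ∫ t in (0 : ℝ)..1, min t s = s ^ 2 / 2 + (1 - s) * s := by
    rw [← intervalIntegral.integral_add_adjacent_intervals (hc.intervalIntegrable 0 s)
      (hc.intervalIntegrable s 1)]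
    congr 1
    · rw [intervalIntegral.integral_congr (g := fun t => t)]
      · simp
      · intro t ht
        rw [Set.uIcc_of_le hs.1] at ht
        exact min_eq_left ht.2
    · rw [intervalIntegral.integral_congr (g := fun _ => s)]
      · simp
      · intro t ht
        rw [Set.uIcc_of_le hs.2] at ht
        exact min_eq_right ht.1
  rw [intervalIntegral.integral_sub (hc.intervalIntegrable _ _)
    ((by fun_prop : Continuous fun t : ℝ => s * t).intervalIntegrable _ _), hmin,
    intervalIntegral.integral_const_mul, integral_id]
  ring

lemma intervalIntegral_half_sub_sq : ∫ s in (0 : ℝ)..1, (s / 2 - s ^ 2 / 2) = 1 / 12 := by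
  rw [intervalIntegral.integral_sub
    ((by fun_prop : Continuous fun s : ℝ => s / 2).intervalIntegrable _ _)
    ((by fun_prop : Continuous fun s : ℝ => s ^ 2 / 2).intervalIntegrable _ _),
    intervalIntegral.integral_div, intervalIntegral.integral_div, integral_id, integral_pow]
  norm_num

lemma sum_cbEntry {m n : ℕ} {Δ : Matrix (Fin m) (Fin n) ℝ} (hm : 1 ≤ m)
    (hΔ : IsCheckerboard m n Δ) :
    ∑ k ∈ range m, ∑ l ∈ range n, cbEntry m n Δ k l = 1 := by
  have hm' : (m : ℝ) ≠ 0 := by positivity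
  rw [sum_range]
  simp [sum_range, cbEntry, hΔ.2.2, hm']

/-- The double integral of the difference of the two copulas. -/
lemma intervalIntegral_checkMin_sub_checkPi {m n : ℕ} (hm : 1 ≤ m) (hn : 1 ≤ n)
    {Δ : Matrix (Fin m) (Fin n) ℝ} (hΔ : IsCheckerboard m n Δ) :
    (∫ u in (0:ℝ)..1, ∫ v in (0:ℝ)..1, (checkMin m n Δ u v - checkPi m n Δ u v))
      = 1 / (12 * (m : ℝ) * n) := by
  have hdiff (u v : ℝ) : checkMin m n Δ u v - checkPi m n Δ u v
      = cbEntry m n Δ (cbIdx m u) (cbIdx n v) *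
        (min (n * v - cbIdx n v) (m * u - cbIdx m u)
          - (m * u - cbIdx m u) * (n * v - cbIdx n v)) := by
    unfold checkMin checkPi
    ring
  simp only [hdiff]
  rw [intervalIntegral_intervalIntegral_cbIdx hm hn
    (H := fun k l s t => cbEntry m n Δ k l * (min t s - s * t)) (fun k l => by fun_prop)]
  have hcell (k : ℕ) : ∫ s in (0 : ℝ)..1, ∑ l ∈ range n, 1 / (n : ℝ) *
      ∫ t in (0 : ℝ)..1, cbEntry m n Δ k l * (min t s - s * t)
      = (∑ l ∈ range n, cbEntry m n Δ k l) * (1 / n) * (1 / 12) := by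
    rw [← intervalIntegral_half_sub_sq, ← intervalIntegral.integral_const_mul]
    refine intervalIntegral.integral_congr fun s hs => ?_
    rw [Set.uIcc_of_le zero_le_one] at hs
    simp only [intervalIntegral.integral_const_mul, intervalIntegral_min_sub_mul hs, sum_mul]
    exact sum_congr rfl fun l _ => by ring
  simp only [hcell]
  rw [← mul_sum, ← sum_mul, ← sum_mul, sum_cbEntry hm hΔ]
  ring

/-- `∫_{[0,1]²} (C_↗^Δ − C_Π^Δ) = 1/(12mn)`, and consequently
`ρ_S(C_↗^Δ) = ρ_S(C_Π^Δ) + 1/(mn)` where `ρ_S(C) = 12∫C − 3`. -/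
theorem checkmin_spearman_rho (m n : ℕ) (hm : 1 ≤ m) (hn : 1 ≤ n)
    (Δ : Matrix (Fin m) (Fin n) ℝ) (hΔ : IsCheckerboard m n Δ) :
    (∫ u in (0:ℝ)..1, ∫ v in (0:ℝ)..1, (checkMin m n Δ u v - checkPi m n Δ u v))
      = 1 / (12 * (m : ℝ) * n) ∧
    12 * (∫ u in (0:ℝ)..1, ∫ v in (0:ℝ)..1, checkMin m n Δ u v) - 3
      = (12 * (∫ u in (0:ℝ)..1, ∫ v in (0:ℝ)..1, checkPi m n Δ u v) - 3)
          + 1 / ((m : ℝ) * n) := by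
  have hdiff := intervalIntegral_checkMin_sub_checkPi hm hn hΔ
  refine ⟨hdiff, ?_⟩
  let A (k l : ℕ) (s t : ℝ) : ℝ := (∑ i ∈ range k, ∑ j ∈ range l, cbEntry m n Δ i j)
    + t * (∑ i ∈ range k, cbEntry m n Δ i l) + s * ∑ j ∈ range l, cbEntry m n Δ k j
  let P (k l : ℕ) (s t : ℝ) : ℝ := A k l s t + cbEntry m n Δ k l * s * t
  let M (k l : ℕ) (s t : ℝ) : ℝ := A k l s t + cbEntry m n Δ k l * min t s
  have hP (k l : ℕ) : Continuous (Function.uncurry (P k l)) := by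
    simp only [P, A, Function.uncurry_def]; fun_prop
  have hM (k l : ℕ) : Continuous (Function.uncurry (M k l)) := by
    simp only [M, A, Function.uncurry_def]; fun_prop
  have hinner (H : ℕ → ℕ → ℝ → ℝ → ℝ) (hH : ∀ k l, Continuous (Function.uncurry (H k l)))
      (k : ℕ) (s : ℝ) :
      IntervalIntegrable (fun v => H k (cbIdx n v) s (n * v - cbIdx n v)) volume 0 1 :=
    intervalIntegrable_cbIdx hn (F := fun l t => H k l s t)
      fun l => (hH k l).comp (by fun_prop : Continuous fun t : ℝ => (s, t))
  have hsub : (∫ u in (0:ℝ)..1, ∫ v in (0:ℝ)..1, (checkMin m n Δ u v - checkPi m n Δ u v))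
      = (∫ u in (0:ℝ)..1, ∫ v in (0:ℝ)..1, checkMin m n Δ u v)
        - ∫ u in (0:ℝ)..1, ∫ v in (0:ℝ)..1, checkPi m n Δ u v := by
    refine Eq.trans ?_ (intervalIntegral.integral_sub
      (intervalIntegrable_intervalIntegral_cbIdx hm hn hM)
      (intervalIntegrable_intervalIntegral_cbIdx hm hn hP))
    exact intervalIntegral.integral_congr fun u _ =>
      intervalIntegral.integral_sub (hinner M hM _ _) (hinner P hP _ _)
  rw [hsub] at hdiff
  have h12 : 12 * (1 / (12 * (m : ℝ) * n)) = 1 / ((m : ℝ) * n) := by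
    field_simp
  linarith
end

section
/- Let m, n ≥ 1 and let Δ be an m×n checkerboard matrix. Define p, q : [0,1)² → ℝ by p(u,v) = m·( ∑_{l=1}^{j−1} Δ_{i,l} + Δ_{i,j}(nv−j+1) ) and q(u,v) = n·( ∑_{k=1}^{i−1} Δ_{k,j} + Δ_{i,j}(mu−i+1) ) for (u,v) ∈ I_{i,j} (these are the a.e. partial derivatives ∂₁C_Π^Δ and ∂₂C_Π^Δ of the checkerboard copula). Then ∫_{[0,1]²} p(u,v)·q(u,v) du dv = (1/4) tr( Ξ^{(m)} Δ Ξ^{(n)} Δᵀ ), where Ξ^{(m)} is the m×m matrix with entries 2 if i>j, 1 if i=j, 0 if i<j, and Ξ^{(n)} is the analogous n×n matrix. Consequently, Kendall's tau τ(C_Π^Δ) = 1 − 4∫_{[0,1]²} p·q dλ² equals 1 − tr( Ξ^{(m)} Δ Ξ^{(n)} Δᵀ ). -/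
open MeasureTheory Finset

/-- The a.e. partial derivative `∂₁C_Π^Δ` of the checkerboard copula:
`p(u,v) = m(∑_{l<j} Δᵢₗ + Δᵢⱼ(nv−j+1))` on cell `Iᵢⱼ`. -/
noncomputable def pPi (m n : ℕ) (Δ : Matrix (Fin m) (Fin n) ℝ) (u v : ℝ) : ℝ :=
  (m : ℝ) * ((∑ l ∈ Finset.range (cbIdx n v), cbEntry m n Δ (cbIdx m u) l)
    + cbEntry m n Δ (cbIdx m u) (cbIdx n v) * ((n : ℝ) * v - cbIdx n v))

/-- The a.e. partial derivative `∂₂C_Π^Δ` of the checkerboard copula: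
`q(u,v) = n(∑_{k<i} Δₖⱼ + Δᵢⱼ(mu−i+1))` on cell `Iᵢⱼ`. -/
noncomputable def qPi (m n : ℕ) (Δ : Matrix (Fin m) (Fin n) ℝ) (u v : ℝ) : ℝ :=
  (n : ℝ) * ((∑ k ∈ Finset.range (cbIdx m u), cbEntry m n Δ k (cbIdx n v))
    + cbEntry m n Δ (cbIdx m u) (cbIdx n v) * ((m : ℝ) * u - cbIdx m u))

/-- The matrix `Ξ^{(m)}`: entries `2` below the diagonal, `1` on it, `0` above. -/
noncomputable def xiMat (m : ℕ) : Matrix (Fin m) (Fin m) ℝ := fun i j =>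
  if j < i then 2 else if i = j then 1 else 0

theorem cbIdx_eq_of_mem_Ico {m k : ℕ} (hk : k < m) {u : ℝ}
    (hu : u ∈ Set.Ico ((k : ℝ) / m) (((k + 1 : ℕ) : ℝ) / m)) : cbIdx m u = k := by
  have hm : (0 : ℝ) < m := by exact_mod_cast (Nat.zero_le k).trans_lt hk
  obtain ⟨h1, h2⟩ := hu
  rw [div_le_iff₀ hm] at h1
  rw [lt_div_iff₀ hm] at h2
  push_cast at h2
  have hfloor : ⌊(m : ℝ) * u⌋₊ = k := by
    rw [Nat.floor_eq_iff (by nlinarith [Nat.cast_nonneg (α := ℝ) k])]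
    constructor <;> nlinarith
  rw [cbIdx, hfloor]
  omega

/-- The integral over `[0,1]` of a function that is affine on each of the `m` cells, in terms of
the cell index and the relative position inside the cell. -/
theorem integral_affine_on_cells {m : ℕ} (hm : 1 ≤ m) (a b : ℕ → ℝ) :
    ∫ u in (0 : ℝ)..1, (a (cbIdx m u) + b (cbIdx m u) * ((m : ℝ) * u - cbIdx m u))
      = (1 / m) * ∑ k ∈ range m, (a k + b k / 2) := by
  have hm0 : (m : ℝ) ≠ 0 := by positivity
  set f : ℝ → ℝ := fun u => a (cbIdx m u) + b (cbIdx m u) * ((m : ℝ) * u - cbIdx m u) with hf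
  let c : ℕ → ℝ := fun k => (k : ℝ) / m
  have hc : ∀ k, c k ≤ c (k + 1) := fun k => by
    simp only [c]
    gcongr
    omega
  have heq : ∀ k < m, Set.EqOn (fun u => a k + b k * ((m : ℝ) * u - k)) f
      (Set.Ioo (c k) (c (k + 1))) := fun k hk u hu => by
    simp only [hf, cbIdx_eq_of_mem_Ico hk (Set.Ioo_subset_Ico_self hu)]
  have hint : ∀ k < m, IntervalIntegrable f volume (c k) (c (k + 1)) := fun k hk => by
    have h : IntervalIntegrable (fun u => a k + b k * ((m : ℝ) * u - k)) volume
        (c k) (c (k + 1)) := Continuous.intervalIntegrable (by fun_prop) _ _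
    rw [intervalIntegrable_iff_integrableOn_Ioo_of_le (hc k)] at h ⊢
    exact h.congr_fun (heq k hk) measurableSet_Ioo
  have hval : ∀ k < m, ∫ u in (c k)..(c (k + 1)), f u = (1 / m) * (a k + b k / 2) := fun k hk => by
    have h : ∫ u in (c k)..(c (k + 1)), f u
        = ∫ u in (c k)..(c (k + 1)), ((a k - b k * k) + b k * m * u) := by
      rw [intervalIntegral.integral_of_le (hc k), intervalIntegral.integral_of_le (hc k),
        integral_Ioc_eq_integral_Ioo, integral_Ioc_eq_integral_Ioo]
      refine setIntegral_congr_fun measurableSet_Ioo fun u hu => ?_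
      rw [← heq k hk hu]
      ring
    rw [h, intervalIntegral.integral_add (by simp)
      (Continuous.intervalIntegrable (by fun_prop) _ _),
      intervalIntegral.integral_const, intervalIntegral.integral_const_mul, integral_id]
    simp only [c, smul_eq_mul]
    push_cast
    field_simp
    ring
  have hsum := intervalIntegral.sum_integral_adjacent_intervals hint
  rw [show c 0 = 0 by simp [c], show c m = 1 by simp [c, hm0]] at hsum
  rw [← hsum, mul_sum]
  exact sum_congr rfl fun k hk => hval k (mem_range.mp hk)

theorem sum_xiMat_mul {m : ℕ} (i : Fin m) (g : ℕ → ℝ) :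
    ∑ k : Fin m, xiMat m i k * g k = 2 * (∑ k ∈ range i, g k) + g i := by
  have h : ∀ k : Fin m, xiMat m i k * g k
      = (fun k : ℕ => (if k < (i : ℕ) then 2 * g k else 0) + if k = (i : ℕ) then g k else 0) k := by
    intro k
    rcases lt_trichotomy k i with hlt | rfl | hgt
    · simp [xiMat, hlt, Fin.val_inj, hlt.ne]
    · simp [xiMat]
    · simp [xiMat, hgt.not_gt, hgt.ne, hgt.ne', Fin.val_inj]
  rw [sum_congr rfl fun k _ => h k, Fin.sum_univ_eq_sum_range
    (fun k : ℕ => (if k < (i : ℕ) then 2 * g k else 0) + if k = (i : ℕ) then g k else 0),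
    sum_add_distrib, ← sum_filter, ← sum_filter, mul_sum]
  congr 1
  · refine sum_congr ?_ fun _ _ => rfl
    ext k
    have := i.isLt
    simp only [mem_filter, mem_range]
    omega
  · rw [sum_filter, sum_ite_eq' (range m) (i : ℕ) g, if_pos (mem_range.mpr i.isLt)]

theorem cbEntry_val {m n : ℕ} (Δ : Matrix (Fin m) (Fin n) ℝ) (i : Fin m) (j : Fin n) :
    cbEntry m n Δ i j = Δ i j := by
  simp [cbEntry]

theorem trace_xiMat_mul {m n : ℕ} (Δ : Matrix (Fin m) (Fin n) ℝ) :
    Matrix.trace (xiMat m * Δ * xiMat n * Δ.transpose)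
      = ∑ i ∈ range m, ∑ j ∈ range n,
        (2 * (∑ l ∈ range j, cbEntry m n Δ i l) + cbEntry m n Δ i j)
          * (2 * (∑ k ∈ range i, cbEntry m n Δ k j) + cbEntry m n Δ i j) := by
  rw [Matrix.mul_assoc, Matrix.trace, ← Fin.sum_univ_eq_sum_range
    (fun i => ∑ j ∈ range n, (2 * (∑ l ∈ range j, cbEntry m n Δ i l) + cbEntry m n Δ i j)
      * (2 * (∑ k ∈ range i, cbEntry m n Δ k j) + cbEntry m n Δ i j))]
  refine sum_congr rfl fun i _ => ?_
  rw [Matrix.diag_apply, Matrix.mul_apply, ← Fin.sum_univ_eq_sum_range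
    (fun j => (2 * (∑ l ∈ range j, cbEntry m n Δ i l) + cbEntry m n Δ i j)
      * (2 * (∑ k ∈ range i, cbEntry m n Δ k j) + cbEntry m n Δ i j))]
  refine sum_congr rfl fun j _ => ?_
  rw [Matrix.mul_apply, Matrix.mul_apply, ← sum_xiMat_mul j fun l => cbEntry m n Δ i l,
    ← sum_xiMat_mul i fun k => cbEntry m n Δ k j, mul_comm]
  simp only [cbEntry_val, Matrix.transpose_apply]

theorem integral_pPi_mul_qPi {m n : ℕ} (hm : 1 ≤ m) (hn : 1 ≤ n)
    (Δ : Matrix (Fin m) (Fin n) ℝ) :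
    ∫ u in (0 : ℝ)..1, ∫ v in (0 : ℝ)..1, pPi m n Δ u v * qPi m n Δ u v
      = ∑ i ∈ range m, ∑ j ∈ range n,
        ((∑ l ∈ range j, cbEntry m n Δ i l) + cbEntry m n Δ i j / 2)
          * ((∑ k ∈ range i, cbEntry m n Δ k j) + cbEntry m n Δ i j / 2) := by
  have hm0 : (m : ℝ) ≠ 0 := by positivity
  have hn0 : (n : ℝ) ≠ 0 := by positivity
  let d : ℕ → ℕ → ℝ := cbEntry m n Δ
  let R : ℕ → ℕ → ℝ := fun i j => ∑ l ∈ range j, d i l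
  let S : ℕ → ℕ → ℝ := fun i j => ∑ k ∈ range i, d k j
  let a : ℕ → ℝ := fun i => m * ∑ j ∈ range n, (R i j + d i j / 2) * S i j
  let b : ℕ → ℝ := fun i => m * ∑ j ∈ range n, (R i j + d i j / 2) * d i j
  have hinner : ∀ u : ℝ, ∫ v in (0 : ℝ)..1, pPi m n Δ u v * qPi m n Δ u v
      = a (cbIdx m u)
        + b (cbIdx m u)
          * ((m : ℝ) * u - cbIdx m u) := by
    intro u
    let Q : ℕ → ℝ := fun j =>
      m * n * (S (cbIdx m u) j + d (cbIdx m u) j * ((m : ℝ) * u - cbIdx m u))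
    have h := integral_affine_on_cells hn (fun j => R (cbIdx m u) j * Q j)
      (fun j => d (cbIdx m u) j * Q j)
    trans (1 / n) * ∑ j ∈ range n, (R (cbIdx m u) j * Q j + d (cbIdx m u) j * Q j / 2)
    · rw [← h]
      refine intervalIntegral.integral_congr fun v _ => ?_
      simp only [pPi, qPi, Q, R, S, d]
      ring
    · simp only [a, b, mul_sum, sum_mul, ← sum_add_distrib]
      refine sum_congr rfl fun j _ => ?_
      simp only [Q]
      field_simp
  rw [intervalIntegral.integral_congr fun u _ => hinner u, integral_affine_on_cells hm a b, mul_sum]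
  refine sum_congr rfl fun i _ => ?_
  simp only [a, b, mul_sum, sum_div, ← sum_add_distrib]
  refine sum_congr rfl fun j _ => ?_
  simp only [R, S, d]
  field_simp

/-- `∫_{[0,1]²} p·q = (1/4) tr(Ξ^{(m)} Δ Ξ^{(n)} Δᵀ)`, and consequently
Kendall's tau `τ(C_Π^Δ) = 1 − 4∫ p·q = 1 − tr(Ξ^{(m)} Δ Ξ^{(n)} Δᵀ)`. -/
theorem checkerboard_kendall_tau (m n : ℕ) (hm : 1 ≤ m) (hn : 1 ≤ n)
    (Δ : Matrix (Fin m) (Fin n) ℝ) (hΔ : IsCheckerboard m n Δ) :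
    (∫ u in (0:ℝ)..1, ∫ v in (0:ℝ)..1, pPi m n Δ u v * qPi m n Δ u v)
      = (1 / 4) * Matrix.trace (xiMat m * Δ * xiMat n * Δ.transpose) ∧
    1 - 4 * (∫ u in (0:ℝ)..1, ∫ v in (0:ℝ)..1, pPi m n Δ u v * qPi m n Δ u v)
      = 1 - Matrix.trace (xiMat m * Δ * xiMat n * Δ.transpose) := by
  have h : (∫ u in (0:ℝ)..1, ∫ v in (0:ℝ)..1, pPi m n Δ u v * qPi m n Δ u v)
      = (1 / 4) * Matrix.trace (xiMat m * Δ * xiMat n * Δ.transpose) := by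
    rw [integral_pPi_mul_qPi hm hn, trace_xiMat_mul]
    simp only [mul_sum (range m), mul_sum (range n)]
    refine sum_congr rfl fun i _ => sum_congr rfl fun j _ => ?_
    ring
  exact ⟨h, by rw [h]; ring⟩
end

section
/- Let m, n ≥ 1 and let Δ be an m×n checkerboard matrix. Define p↗, q↗ : [0,1)² → ℝ by p↗(u,v) = m·( ∑_{l=1}^{j−1} Δ_{i,l} + Δ_{i,j}·1{nv−j+1 ≥ mu−i+1} ) and q↗(u,v) = n·( ∑_{k=1}^{i−1} Δ_{k,j} + Δ_{i,j}·1{mu−i+1 ≥ nv−j+1} ) for (u,v) ∈ I_{i,j} (these are the a.e. partial derivatives ∂₁C_↗^Δ and ∂₂C_↗^Δ of the check–min copula). Then ∫_{[0,1]²} p↗(u,v)·q↗(u,v) du dv = (1/4)·( tr( Ξ^{(m)} Δ Ξ^{(n)} Δᵀ ) − tr(Δᵀ Δ) ), where Ξ^{(m)} is the m×m matrix with entries 2 if i>j, 1 if i=j, 0 if i<j, and Ξ^{(n)} is the analogous n×n matrix. Consequently, Kendall's tau satisfies τ(C_↗^Δ) = τ(C_Π^Δ) + tr(Δᵀ Δ).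 -/
open MeasureTheory Finset

/-- The a.e. partial derivative `∂₁C_↗^Δ` of the check–min copula:
`p↗(u,v) = m(∑_{l<j} Δᵢₗ + Δᵢⱼ·1{nv−j+1 ≥ mu−i+1})` on cell `Iᵢⱼ`. -/
noncomputable def pMin (m n : ℕ) (Δ : Matrix (Fin m) (Fin n) ℝ) (u v : ℝ) : ℝ :=
  (m : ℝ) * ((∑ l ∈ Finset.range (cbIdx n v), cbEntry m n Δ (cbIdx m u) l)
    + cbEntry m n Δ (cbIdx m u) (cbIdx n v) *
        (if (m : ℝ) * u - cbIdx m u ≤ (n : ℝ) * v - cbIdx n v then 1 else 0))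

/-- The a.e. partial derivative `∂₂C_↗^Δ` of the check–min copula:
`q↗(u,v) = n(∑_{k<i} Δₖⱼ + Δᵢⱼ·1{mu−i+1 ≥ nv−j+1})` on cell `Iᵢⱼ`. -/
noncomputable def qMin (m n : ℕ) (Δ : Matrix (Fin m) (Fin n) ℝ) (u v : ℝ) : ℝ :=
  (n : ℝ) * ((∑ k ∈ Finset.range (cbIdx m u), cbEntry m n Δ k (cbIdx n v))
    + cbEntry m n Δ (cbIdx m u) (cbIdx n v) *
        (if (n : ℝ) * v - cbIdx n v ≤ (m : ℝ) * u - cbIdx m u then 1 else 0))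

/-- An integral over `[0,1]` splits along the cells `[i/m, (i+1)/m)`, each rescaled to `[0,1]`. -/
lemma integral_eq_sum_rescaled_cells {m : ℕ} (hm : 1 ≤ m) {f : ℝ → ℝ} {g : ℕ → ℝ → ℝ}
    (hg : ∀ i < m, IntervalIntegrable (g i) volume 0 1)
    (hfg : ∀ i < m, ∀ u, (m : ℝ) * u - i ∈ Set.Ioo (0 : ℝ) 1 → f u = g i (m * u - i)) :
    ∫ u in (0 : ℝ)..1, f u = (m : ℝ)⁻¹ * ∑ i ∈ range m, ∫ s in (0 : ℝ)..1, g i s := by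
  have hm0 : (0 : ℝ) < m := by exact_mod_cast hm
  have hle (i : ℕ) : (i : ℝ) / m ≤ ((i + 1 : ℕ) : ℝ) / m := by gcongr; simp
  have hcell (i : ℕ) (hi : i < m) :
      Set.EqOn (fun u => g i (m * u - i)) f (Set.Ioo ((i : ℝ) / m) (((i + 1 : ℕ) : ℝ) / m)) := by
    rintro u ⟨h1, h2⟩
    rw [div_lt_iff₀ hm0] at h1
    rw [lt_div_iff₀ hm0] at h2
    push_cast at h2
    exact (hfg i hi u ⟨by linarith, by linarith⟩).symm
  have hint (i : ℕ) (hi : i < m) :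
      IntervalIntegrable f volume ((i : ℝ) / m) (((i + 1 : ℕ) : ℝ) / m) := by
    have h := ((hg i hi).comp_sub_right (i : ℝ)).comp_mul_left (c := (m : ℝ))
    rw [zero_add, add_comm (1 : ℝ), ← Nat.cast_succ] at h
    exact h.congr_uIoo (by rw [Set.uIoo_of_le (hle i)]; exact hcell i hi)
  have hsum := intervalIntegral.sum_integral_adjacent_intervals hint
  rw [Nat.cast_zero, zero_div, div_self hm0.ne'] at hsum
  rw [← hsum, mul_sum]
  refine sum_congr rfl fun i hi => ?_
  rw [← intervalIntegral.integral_congr_Ioo_of_le (hle i) (hcell i (mem_range.mp hi)),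
    intervalIntegral.integral_comp_mul_sub (g i) hm0.ne', mul_div_cancel₀ _ hm0.ne',
    mul_div_cancel₀ _ hm0.ne']
  simp

lemma cbIdx_eq {m i : ℕ} (hi : i < m) {u : ℝ} (hu : (m : ℝ) * u - i ∈ Set.Ioo (0 : ℝ) 1) :
    cbIdx m u = i := by
  have h : ⌊(m : ℝ) * u⌋₊ = i := by
    rw [Nat.floor_eq_iff (by linarith [hu.1, (Nat.cast_nonneg i : (0 : ℝ) ≤ i)])]
    exact ⟨by linarith [hu.1], by linarith [hu.2]⟩
  rw [cbIdx, h]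
  omega

/-- The two diagonal indicators overlap only in a null set, so the quadratic term vanishes. -/
lemma integral_diagonal_cell (a b R S D : ℝ) {s : ℝ} (hs : s ∈ Set.Ioo (0 : ℝ) 1) :
    IntervalIntegrable (fun t : ℝ => a * (R + D * (if s ≤ t then 1 else 0)) *
      (b * (S + D * (if t ≤ s then 1 else 0)))) volume 0 1 ∧
    ∫ t in (0 : ℝ)..1, a * (R + D * (if s ≤ t then 1 else 0)) *
      (b * (S + D * (if t ≤ s then 1 else 0))) =
      a * b * (R * S + D * S * (1 - s) + D * R * s) := by
  have hl : Set.EqOn (fun _ : ℝ => a * R * (b * (S + D))) (fun t : ℝ =>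
      a * (R + D * (if s ≤ t then 1 else 0)) * (b * (S + D * (if t ≤ s then 1 else 0))))
      (Set.uIoo 0 s) := by
    rw [Set.uIoo_of_le hs.1.le]
    rintro t ⟨-, ht⟩
    simp [ht.le, ht.not_ge]
  have hr : Set.EqOn (fun _ : ℝ => a * (R + D) * (b * S)) (fun t : ℝ =>
      a * (R + D * (if s ≤ t then 1 else 0)) * (b * (S + D * (if t ≤ s then 1 else 0))))
      (Set.uIoo s 1) := by
    rw [Set.uIoo_of_le hs.2.le]
    rintro t ⟨ht, -⟩
    simp [ht.le, ht.not_ge]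
  have il := (intervalIntegrable_const (μ := volume)).congr_uIoo hl
  have ir := (intervalIntegrable_const (μ := volume)).congr_uIoo hr
  refine ⟨il.trans ir, ?_⟩
  rw [← intervalIntegral.integral_add_adjacent_intervals il ir,
    ← intervalIntegral.integral_congr_uIoo hl, ← intervalIntegral.integral_congr_uIoo hr]
  simp only [intervalIntegral.integral_const, smul_eq_mul]
  ring

lemma integral_pMin_mul_qMin_inner {m n i : ℕ} (hn : 1 ≤ n) (hi : i < m)
    (Δ : Matrix (Fin m) (Fin n) ℝ) {u : ℝ} (hu : (m : ℝ) * u - i ∈ Set.Ioo (0 : ℝ) 1) :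
    ∫ v in (0 : ℝ)..1, pMin m n Δ u v * qMin m n Δ u v =
      m * ∑ j ∈ range n,
        ((∑ l ∈ range j, cbEntry m n Δ i l) * (∑ k ∈ range i, cbEntry m n Δ k j)
          + cbEntry m n Δ i j * (∑ k ∈ range i, cbEntry m n Δ k j) * (1 - (m * u - i))
          + cbEntry m n Δ i j * (∑ l ∈ range j, cbEntry m n Δ i l) * (m * u - i)) := by
  have hn0 : (n : ℝ) ≠ 0 := by positivity
  rw [integral_eq_sum_rescaled_cells hn
    (fun j _ => (integral_diagonal_cell m n (∑ l ∈ range j, cbEntry m n Δ i l)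
      (∑ k ∈ range i, cbEntry m n Δ k j) (cbEntry m n Δ i j) hu).1)]
  · simp_rw [(integral_diagonal_cell _ _ _ _ _ hu).2]
    rw [← mul_sum, mul_comm (m : ℝ) n, mul_assoc, inv_mul_cancel_left₀ hn0]
  · intro j hj v hv
    simp only [pMin, qMin, cbIdx_eq hi hu, cbIdx_eq hj hv]

lemma integral_pMin_mul_qMin {m n : ℕ} (hm : 1 ≤ m) (hn : 1 ≤ n)
    (Δ : Matrix (Fin m) (Fin n) ℝ) :
    ∫ u in (0 : ℝ)..1, ∫ v in (0 : ℝ)..1, pMin m n Δ u v * qMin m n Δ u v =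
      ∑ i ∈ range m, ∑ j ∈ range n,
        ((∑ l ∈ range j, cbEntry m n Δ i l) * (∑ k ∈ range i, cbEntry m n Δ k j)
          + cbEntry m n Δ i j * (∑ k ∈ range i, cbEntry m n Δ k j) * (1 / 2)
          + cbEntry m n Δ i j * (∑ l ∈ range j, cbEntry m n Δ i l) * (1 / 2)) := by
  have hm0 : (m : ℝ) ≠ 0 := by positivity
  rw [integral_eq_sum_rescaled_cells hm (g := fun i s => m * ∑ j ∈ range n,
        ((∑ l ∈ range j, cbEntry m n Δ i l) * (∑ k ∈ range i, cbEntry m n Δ k j)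
          + cbEntry m n Δ i j * (∑ k ∈ range i, cbEntry m n Δ k j) * (1 - s)
          + cbEntry m n Δ i j * (∑ l ∈ range j, cbEntry m n Δ i l) * s))
    (fun i _ => Continuous.intervalIntegrable (by fun_prop) _ _)
    (fun i hi u hu => integral_pMin_mul_qMin_inner hn hi Δ hu), mul_sum]
  refine sum_congr rfl fun i _ => ?_
  rw [intervalIntegral.integral_const_mul, inv_mul_cancel_left₀ hm0,
    intervalIntegral.integral_finsetSum
      (fun j _ => Continuous.intervalIntegrable (by fun_prop) _ _)]
  refine sum_congr rfl fun j _ => ?_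
  have affine (A B C : ℝ) :
      ∫ s in (0 : ℝ)..1, (A + B * (1 - s) + C * s) = A + B * (1 / 2) + C * (1 / 2) := by
    have h : (fun s : ℝ => A + B * (1 - s) + C * s) = fun s => (A + B) + (C - B) * s := by
      ext s; ring
    rw [h, intervalIntegral.integral_add (by simp)
      (Continuous.intervalIntegrable (by fun_prop) _ _), intervalIntegral.integral_const_mul,
      integral_id, intervalIntegral.integral_const, smul_eq_mul]
    ring
  exact affine _ _ _

lemma sum_range_eq_sum_fin_ite {n : ℕ} (f : ℕ → ℝ) (j : Fin n) :
    ∑ l ∈ range j, f l = ∑ l : Fin n, if l < j then f l else 0 := by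
  have h : range (j : ℕ) = (range n).filter (· < (j : ℕ)) := by
    ext l
    have := j.isLt
    simp only [mem_range, mem_filter]
    omega
  rw [h, sum_filter, sum_range]
  rfl

lemma sum_xiMat_mul_s14 {n : ℕ} (f : Fin n → ℝ) (j : Fin n) :
    ∑ l, xiMat n j l * f l = 2 * (∑ l, if l < j then f l else 0) + f j := by
  have h : f j = ∑ l, if j = l then f l else 0 := by simp
  rw [h, mul_sum, ← sum_add_distrib]
  refine sum_congr rfl fun l _ => ?_
  rcases lt_trichotomy l j with hl | rfl | hl
  · simp [xiMat, hl, hl.ne']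
  · simp [xiMat]
  · simp [xiMat, hl.not_gt, hl.ne]

lemma trace_xiMat {m n : ℕ} (Δ : Matrix (Fin m) (Fin n) ℝ) :
    Matrix.trace (xiMat m * Δ * xiMat n * Δ.transpose) =
      ∑ i, ∑ j, (∑ k, xiMat m i k * Δ k j) * ∑ l, xiMat n j l * Δ i l := by
  rw [Matrix.mul_assoc]
  simp only [Matrix.trace, Matrix.diag, Matrix.mul_apply (M := xiMat m * Δ),
    Matrix.mul_apply (M := xiMat m), Matrix.mul_apply (M := xiMat n), Matrix.transpose_apply]

lemma trace_transpose_mul_self {m n : ℕ} (Δ : Matrix (Fin m) (Fin n) ℝ) :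
    Matrix.trace (Δ.transpose * Δ) = ∑ i, ∑ j, Δ i j * Δ i j := by
  rw [sum_comm]
  simp only [Matrix.trace, Matrix.diag, Matrix.mul_apply, Matrix.transpose_apply]

/-- `∫_{[0,1]²} p↗·q↗ = (1/4)(tr(Ξ^{(m)} Δ Ξ^{(n)} Δᵀ) − tr(Δᵀ Δ))`,
and consequently `τ(C_↗^Δ) = 1 − 4∫ p↗·q↗ = τ(C_Π^Δ) + tr(Δᵀ Δ)`, where
`τ(C_Π^Δ) = 1 − tr(Ξ^{(m)} Δ Ξ^{(n)} Δᵀ)`. -/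
theorem checkmin_kendall_tau (m n : ℕ) (hm : 1 ≤ m) (hn : 1 ≤ n)
    (Δ : Matrix (Fin m) (Fin n) ℝ) (hΔ : IsCheckerboard m n Δ) :
    (∫ u in (0:ℝ)..1, ∫ v in (0:ℝ)..1, pMin m n Δ u v * qMin m n Δ u v)
      = (1 / 4) * (Matrix.trace (xiMat m * Δ * xiMat n * Δ.transpose)
          - Matrix.trace (Δ.transpose * Δ)) ∧
    1 - 4 * (∫ u in (0:ℝ)..1, ∫ v in (0:ℝ)..1, pMin m n Δ u v * qMin m n Δ u v)
      = (1 - Matrix.trace (xiMat m * Δ * xiMat n * Δ.transpose))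
          + Matrix.trace (Δ.transpose * Δ) := by
  have key : (∫ u in (0:ℝ)..1, ∫ v in (0:ℝ)..1, pMin m n Δ u v * qMin m n Δ u v)
      = (1 / 4) * (Matrix.trace (xiMat m * Δ * xiMat n * Δ.transpose)
          - Matrix.trace (Δ.transpose * Δ)) := by
    have entry (i : Fin m) (j : Fin n) : cbEntry m n Δ i j = Δ i j := by
      simp [cbEntry]
    rw [integral_pMin_mul_qMin hm hn, trace_xiMat, trace_transpose_mul_self, sum_range,
      ← sum_sub_distrib, mul_sum]
    refine sum_congr rfl fun i _ => ?_
    rw [sum_range, ← sum_sub_distrib, mul_sum]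
    refine sum_congr rfl fun j _ => ?_
    rw [sum_range_eq_sum_fin_ite, sum_range_eq_sum_fin_ite (fun k => cbEntry m n Δ k j)]
    simp only [entry, sum_xiMat_mul_s14]
    ring
  exact ⟨key, by rw [key]; ring⟩
end
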